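/- Rearrangement inequality for random walks (measurable case, almost everywhere): Let φ : ℝ^d → [0,∞) be a probability density (measurable with ∫_{ℝ^d} φ = 1) vanishing at infinity, let f₁,…,f_m : ℝ^d → [0,∞) be measurable functions vanishing at infinity, and let 0 ≤ k₁ ≤ ⋯ ≤ k_m be integers with k_m ≥ 1. Then for Lebesgue-almost every x₀ ∈ ℝ^d, ∫_{(ℝ^d)^{k_m}} ∏_{i=1}^m f_i(x₀ + x₁ + ⋯ + x_{k_i}) ∏_{j=1}^{k_m} φ(x_j) dx₁⋯dx_{k_m} ≤ ∫_{(ℝ^d)^{k_m}} ∏_{i=1}^m f_i*(x₁ + ⋯ + x_{k_i}) ∏_{j=1}^{k_m} φ*(x_j) dx₁⋯dx_{k_m}, where an empty sum of the x_j's is understood to be 0 and both integrals are taken in [0,∞]. -/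

import Mathlib

open MeasureTheory ENNReal Filter Topology
open scoped RealInnerProductSpace

/-- A nonnegative function on `ℝ^d` vanishes at infinity if all its positive
super-level sets have finite Lebesgue measure. -/
def VanishesAtInfinity {d : ℕ} (f : EuclideanSpace ℝ (Fin d) → ℝ) : Prop :=
  ∀ t : ℝ, 0 < t → volume {x : EuclideanSpace ℝ (Fin d) | t < f x} < ⊤

/-- Radius of the ball centered at the origin having the same volume as `A`. -/
noncomputable def symmRadius {d : ℕ} (A : Set (EuclideanSpace ℝ (Fin d))) : ℝ :=
  ((volume A / volume (Metric.ball (0 : EuclideanSpace ℝ (Fin d)) 1)).toReal) ^ ((1 : ℝ) / d)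

/-- `A*`: the open ball centered at the origin with the same Lebesgue measure as `A`. -/
noncomputable def ballStar {d : ℕ} (A : Set (EuclideanSpace ℝ (Fin d))) :
    Set (EuclideanSpace ℝ (Fin d)) :=
  Metric.ball 0 (symmRadius A)

/-- Symmetric decreasing rearrangement `f*` (with values in `[0,∞]`):
`f*(x) = ∫₀^∞ 1_{{f>t}*}(x) dt`. -/
noncomputable def symmRearrange {d : ℕ} (f : EuclideanSpace ℝ (Fin d) → ℝ)
    (x : EuclideanSpace ℝ (Fin d)) : ℝ≥0∞ :=
  ∫⁻ t in Set.Ioi (0 : ℝ), (ballStar {y | t < f y}).indicator (fun _ => (1 : ℝ≥0∞)) x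

/-- `x₁ + ⋯ + x_n` for a configuration `x` (indices shifted by one: `x j` is `x_{j+1}`);
an empty sum is `0`. -/
noncomputable def partialSum {d K : ℕ} (x : Fin K → EuclideanSpace ℝ (Fin d)) (n : ℕ) :
    EuclideanSpace ℝ (Fin d) :=
  ∑ j : Fin K, if (j : ℕ) < n then x j else 0



/-- The pairs `(x, y) ∈ A × B` with `x + y ∈ C`. -/
def sumTriple {G : Type*} [Add G] (A B C : Set G) : Set (G × G) :=
  {p | p.1 ∈ A ∧ p.2 ∈ B ∧ p.1 + p.2 ∈ C}

/-- The open interval centered at the origin of length `a`. -/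
def centeredInterval (a : ℝ) : Set ℝ := {s | 2 * |s| < a}

lemma exists_measure_inter_Ici {A : Set ℝ} {R : ℝ}
    (hAR : A ⊆ Set.Icc (-R) R) (hR : 0 ≤ R) {t : ℝ} (ht : 0 ≤ t)
    (htA : ENNReal.ofReal t ≤ volume A) : ∃ p, volume (A ∩ Set.Ici p) = ENNReal.ofReal t := by
  have hfin : ∀ p, volume (A ∩ Set.Ici p) ≠ ⊤ := fun p =>
    measure_ne_top_of_subset (Set.inter_subset_left.trans hAR) (by simp)
  have hanti : ∀ p q, p ≤ q → volume (A ∩ Set.Ici q) ≤ volume (A ∩ Set.Ici p) := fun p q h =>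
    measure_mono (Set.inter_subset_inter_right _ (Set.Ici_subset_Ici.2 h))
  have hlip : ∀ p q, p ≤ q →
      (volume (A ∩ Set.Ici p)).toReal ≤ (volume (A ∩ Set.Ici q)).toReal + (q - p) := by
    intro p q h
    have h1 : volume (A ∩ Set.Ici p) ≤ volume (A ∩ Set.Ici q) + ENNReal.ofReal (q - p) := by
      rw [← Real.volume_Ico]
      refine (measure_mono ?_).trans (measure_union_le _ _)
      rintro x ⟨hx, hxp⟩
      rcases lt_or_ge x q with hq | hq
      · exact Or.inr ⟨hxp, hq⟩
      · exact Or.inl ⟨hx, hq⟩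
    have h2 := ENNReal.toReal_mono (ENNReal.add_ne_top.2 ⟨hfin q, ENNReal.ofReal_ne_top⟩) h1
    rwa [ENNReal.toReal_add (hfin q) ENNReal.ofReal_ne_top,
      ENNReal.toReal_ofReal (by linarith)] at h2
  have hcont : Continuous fun p => (volume (A ∩ Set.Ici p)).toReal := by
    have : LipschitzWith 1 fun p => (volume (A ∩ Set.Ici p)).toReal := by
      refine LipschitzWith.of_le_add fun p q => ?_
      rcases le_total p q with h | h
      · have := hlip p q h
        rw [Real.dist_eq, abs_sub_comm, abs_of_nonneg (by linarith)]
        exact this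
      · have := ENNReal.toReal_mono (hfin q) (hanti q p h)
        have := dist_nonneg (x := p) (y := q)
        linarith
    exact this.continuous
  have h0 : volume (A ∩ Set.Ici (R + 1)) = 0 := by
    have : A ∩ Set.Ici (R + 1) = ∅ := by
      ext x
      simp only [Set.mem_inter_iff, Set.mem_Ici, Set.mem_empty_iff_false, iff_false]
      rintro ⟨hx, hx'⟩
      have := (hAR hx).2
      linarith
    simp [this]
  have h1 : A ∩ Set.Ici (-R) = A := Set.inter_eq_left.2 fun x hx => (hAR hx).1
  obtain ⟨p, -, hp⟩ := intermediate_value_Icc' (f := fun p => (volume (A ∩ Set.Ici p)).toReal)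
    (show -R ≤ R + 1 by linarith) hcont.continuousOn (show t ∈ Set.Icc _ _ from by
      constructor
      · simpa [h0] using ht
      · simp only [h1]
        rw [← ENNReal.toReal_ofReal ht]
        exact ENNReal.toReal_mono (by simpa [h1] using hfin (-R)) htA)
  refine ⟨p, ?_⟩
  rw [← hp, ENNReal.ofReal_toReal (hfin p)]

lemma exists_measure_inter_Iic {A : Set ℝ} {R : ℝ}
    (hAR : A ⊆ Set.Icc (-R) R) (hR : 0 ≤ R) {t : ℝ} (ht : 0 ≤ t)
    (htA : ENNReal.ofReal t ≤ volume A) : ∃ p, volume (A ∩ Set.Iic p) = ENNReal.ofReal t := by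
  obtain ⟨p, hp⟩ := exists_measure_inter_Ici (A := -A)
    (fun x hx => by have := hAR hx; exact ⟨by linarith [this.2], by linarith [this.1]⟩) hR ht
    (by rwa [Measure.measure_neg])
  refine ⟨-p, ?_⟩
  rw [← hp, ← Measure.measure_neg]
  congr 1
  ext x
  simp

section
variable {G : Type*} [AddCommGroup G]

lemma sumTriple_mono {A B C A' B' C' : Set G} (hA : A ⊆ A') (hB : B ⊆ B') (hC : C ⊆ C') :
    sumTriple A B C ⊆ sumTriple A' B' C' := fun _ h => ⟨hA h.1, hB h.2.1, hC h.2.2⟩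

variable [MeasurableSpace G]

lemma measure_sumTriple_le_mul (μ : Measure G) [SFinite μ] (A B C : Set G) :
    μ.prod μ (sumTriple A B C) ≤ μ A * μ B :=
  (measure_mono fun _ hp => ⟨hp.1, hp.2.1⟩ : _ ≤ μ.prod μ (A ×ˢ B)).trans_eq
    (Measure.prod_prod A B)

variable [MeasurableAdd₂ G]

lemma measurableSet_sumTriple {A B C : Set G} (hA : MeasurableSet A) (hB : MeasurableSet B)
    (hC : MeasurableSet C) : MeasurableSet (sumTriple A B C) :=
  (measurable_fst hA).inter ((measurable_snd hB).inter ((measurable_fst.add measurable_snd) hC))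

variable (μ : Measure G) [SFinite μ]

lemma measure_sumTriple_swap {A B C : Set G} (hA : MeasurableSet A) (hB : MeasurableSet B)
    (hC : MeasurableSet C) : μ.prod μ (sumTriple A B C) = μ.prod μ (sumTriple B A C) := by
  conv_lhs => rw [← Measure.prod_swap]
  rw [Measure.map_apply measurable_swap (measurableSet_sumTriple hA hB hC)]
  congr 1
  ext p
  simp only [sumTriple, Set.mem_preimage, Set.mem_ofPred_eq, Prod.fst_swap, Prod.snd_swap,
    add_comm p.2]
  tauto

variable [μ.IsAddLeftInvariant]

lemma measure_sumTriple_univ_mid {A C : Set G} (hA : MeasurableSet A) (hC : MeasurableSet C) :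
    μ.prod μ (sumTriple A Set.univ C) = μ A * μ C := by
  rw [Measure.prod_apply (measurableSet_sumTriple hA .univ hC), mul_comm,
    ← setLIntegral_const, ← lintegral_indicator hA]
  congr 1 with x
  by_cases hx : x ∈ A
  · simp only [sumTriple, Set.mem_univ, Set.preimage_ofPred_eq, hx, true_and, Set.indicator_of_mem]
    exact measure_preimage_add μ x C
  · simp [sumTriple, hx]

lemma measure_sumTriple_le_mul_right {A C : Set G} (B : Set G) (hA : MeasurableSet A)
    (hC : MeasurableSet C) : μ.prod μ (sumTriple A B C) ≤ μ A * μ C :=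
  (measure_mono (sumTriple_mono le_rfl (Set.subset_univ B) le_rfl)).trans_eq
    (measure_sumTriple_univ_mid μ hA hC)
end

lemma measurableSet_centeredInterval (a : ℝ) : MeasurableSet (centeredInterval a) :=
  measurableSet_lt (by fun_prop) measurable_const

lemma volume_centeredInterval (a : ℝ) : volume (centeredInterval a) = ENNReal.ofReal a := by
  have : centeredInterval a = Set.Ioo (-(a / 2)) (a / 2) := by
    ext s
    simp only [centeredInterval, Set.mem_ofPred_eq, Set.mem_Ioo, ← abs_lt]
    constructor <;> intro h <;> linarith
  rw [this, Real.volume_Ioo]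
  congr 1
  ring

/-- The truncation argument behind the one-dimensional Riesz inequality. -/
lemma volume_sumTriple_le_truncation {A B C : Set ℝ} {R t : ℝ} (hA : MeasurableSet A)
    (hB : MeasurableSet B) (hC : MeasurableSet C) (hAR : A ⊆ Set.Icc (-R) R)
    (hBR : B ⊆ Set.Icc (-R) R) (hR : 0 ≤ R) (ht : 0 ≤ t) (htA : ENNReal.ofReal t ≤ volume A)
    (htB : ENNReal.ofReal t ≤ volume B) :
    volume.prod volume (sumTriple A B C) ≤
      (volume A - ENNReal.ofReal t) * (volume B - ENNReal.ofReal t) +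
        volume C * ENNReal.ofReal t := by
  obtain ⟨p, hp⟩ := exists_measure_inter_Ici hAR hR ht htA
  obtain ⟨q, hq⟩ := exists_measure_inter_Iic hBR hR ht htB
  set S : Set (ℝ × ℝ) := {z | z.1 ∈ A ∧ z.2 ∈ B ∧ (p ≤ z.1 ∨ z.2 ≤ q) ∧ z.1 + z.2 ∈ C} with hS
  have hSm : MeasurableSet S := by
    refine (measurable_fst hA).inter ((measurable_snd hB).inter (MeasurableSet.inter ?_
      ((measurable_fst.add measurable_snd) hC)))
    exact (measurableSet_le measurable_const measurable_fst).union
      (measurableSet_le measurable_snd measurable_const)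
  have hsub : sumTriple A B C ⊆ ((A \ (A ∩ Set.Ici p)) ×ˢ (B \ (B ∩ Set.Iic q))) ∪ S := by
    rintro ⟨x, y⟩ ⟨hx, hy, hxy⟩
    by_cases h : p ≤ x ∨ y ≤ q
    · exact Or.inr ⟨hx, hy, h, hxy⟩
    · rw [not_or] at h
      exact Or.inl ⟨⟨hx, fun h' => h.1 h'.2⟩, ⟨hy, fun h' => h.2 h'.2⟩⟩
  refine (measure_mono hsub).trans ((measure_union_le _ _).trans (add_le_add ?_ ?_))
  · rw [Measure.prod_prod, measure_sdiff Set.inter_subset_left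
      (hA.inter measurableSet_Ici).nullMeasurableSet (by rw [hp]; exact ENNReal.ofReal_ne_top),
      measure_sdiff Set.inter_subset_left
      (hB.inter measurableSet_Iic).nullMeasurableSet (by rw [hq]; exact ENNReal.ofReal_ne_top),
      hp, hq]
  · have hshear : MeasurePreserving (fun z : ℝ × ℝ => (z.2, -z.2 + z.1))
        (volume.prod volume) (volume.prod volume) :=
      measurePreserving_prod_neg_add_swap volume volume
    rw [← hshear.measure_preimage hSm.nullMeasurableSet,
      Measure.prod_apply (hshear.measurable hSm), mul_comm, ← setLIntegral_const,
      ← lintegral_indicator hC]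
    refine lintegral_mono fun s => ?_
    by_cases hs : s ∈ C
    swap
    · simp [hS, hs]
    rw [Set.indicator_of_mem hs]
    rcases le_total (s - q) p with h | h
    · have : Prod.mk s ⁻¹' ((fun z : ℝ × ℝ => (z.2, -z.2 + z.1)) ⁻¹' S) ⊆
          (fun x => s - x) ⁻¹' (B ∩ Set.Iic q) := by
        rintro x ⟨hx, hy, h3, -⟩
        simp only [Set.mem_preimage] at hx hy h3 ⊢
        have e : -x + s = s - x := by ring
        rw [e] at hy h3
        refine ⟨hy, ?_⟩
        rcases h3 with h3 | h3
        · exact Set.mem_Iic.2 (by linarith)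
        · exact h3
      refine (measure_mono this).trans_eq ?_
      rw [← hq]
      exact (Measure.measurePreserving_sub_left volume s).measure_preimage
        (hB.inter measurableSet_Iic).nullMeasurableSet
    · rw [← hp]
      refine measure_mono ?_
      rintro x ⟨hx, hy, h3, -⟩
      simp only at hx hy h3
      refine ⟨hx, ?_⟩
      rcases h3 with h3 | h3
      · exact h3
      · exact Set.mem_Ici.2 (by linarith)

lemma volume_corner_le (a b c : ℝ) (hc : c ≤ a + b) :
    volume.prod volume {z : ℝ × ℝ | z.1 < a ∧ z.2 < b ∧ c ≤ z.1 + z.2} ≤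
      ENNReal.ofReal ((a + b - c) ^ 2 / 2) := by
  have hm : MeasurableSet {z : ℝ × ℝ | z.1 < a ∧ z.2 < b ∧ c ≤ z.1 + z.2} :=
    (measurableSet_lt measurable_fst measurable_const).inter
      ((measurableSet_lt measurable_snd measurable_const).inter
        (measurableSet_le measurable_const (measurable_fst.add measurable_snd)))
  rw [Measure.prod_apply hm]
  have h1 : ∀ x : ℝ, volume (Prod.mk x ⁻¹' {z : ℝ × ℝ | z.1 < a ∧ z.2 < b ∧ c ≤ z.1 + z.2}) ≤
      (Set.Ioc (c - b) a).indicator (fun x => ENNReal.ofReal (x + (b - c))) x := by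
    intro x
    by_cases hx : x ∈ Set.Ioc (c - b) a
    · rw [Set.indicator_of_mem hx, show x + (b - c) = b - (c - x) by ring, ← Real.volume_Ico]
      refine measure_mono ?_
      rintro y ⟨-, h2, h3⟩
      simp only at h2 h3
      exact ⟨by linarith, h2⟩
    · rw [Set.indicator_of_notMem hx]
      refine le_of_eq ?_
      convert measure_empty (μ := (volume : Measure ℝ))
      ext y
      simp only [Set.mem_preimage, Set.mem_ofPred_eq, Set.mem_empty_iff_false, iff_false]
      rintro ⟨h1, h2, h3⟩
      exact hx ⟨by linarith, h1.le⟩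
  refine (lintegral_mono h1).trans_eq ?_
  rw [lintegral_indicator measurableSet_Ioc, ← ofReal_integral_eq_lintegral_ofReal,
    ← intervalIntegral.integral_of_le (by linarith)]
  · congr 1
    rw [intervalIntegral.integral_add (by simp) (by simp), integral_id,
      intervalIntegral.integral_const, smul_eq_mul]
    ring
  · have : Continuous fun x : ℝ => x + (b - c) := by fun_prop
    exact (this.integrableOn_Icc).mono_set Set.Ioc_subset_Icc_self
  · refine (ae_restrict_iff' measurableSet_Ioc).2 (Eventually.of_forall fun x hx => ?_)
    simp only [Pi.zero_apply]
    linarith [hx.1]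

lemma volume_sumTriple_centeredInterval_ge {a b c : ℝ} (ha : 0 ≤ a)
    (hcab : c ≤ a + b) :
    ENNReal.ofReal (a * b) ≤
      volume.prod volume (sumTriple (centeredInterval a) (centeredInterval b) (centeredInterval c))
        + ENNReal.ofReal (((a + b - c) / 2) ^ 2) := by
  set N : Set (ℝ × ℝ) := {z | z.1 < a / 2 ∧ z.2 < b / 2 ∧ c / 2 ≤ z.1 + z.2}
  have hN : volume.prod volume N ≤ ENNReal.ofReal (((a + b - c) / 2) ^ 2 / 2) := by
    refine (volume_corner_le (a / 2) (b / 2) (c / 2) (by linarith)).trans_eq ?_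
    congr 2
    ring
  have hN' : volume.prod volume (-N) = volume.prod volume N :=
    Measure.measure_neg (volume : Measure (ℝ × ℝ)) N
  have hsub : centeredInterval a ×ˢ centeredInterval b ⊆
      sumTriple (centeredInterval a) (centeredInterval b) (centeredInterval c) ∪ (N ∪ -N) := by
    rintro ⟨x, y⟩ ⟨hx, hy⟩
    by_cases hz : x + y ∈ centeredInterval c
    · exact Or.inl ⟨hx, hy, hz⟩
    simp only [centeredInterval, Set.mem_ofPred_eq, not_lt] at hx hy hz
    have hx1 := le_abs_self x
    have hx2 := neg_le_abs x
    have hy1 := le_abs_self y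
    have hy2 := neg_le_abs y
    rcases abs_cases (x + y) with ⟨h, -⟩ | ⟨h, -⟩
    · refine Or.inr (Or.inl ⟨?_, ?_, ?_⟩) <;> simp only <;> linarith
    · refine Or.inr (Or.inr ⟨?_, ?_, ?_⟩) <;> simp only [Prod.fst_neg, Prod.snd_neg] <;> linarith
  calc ENNReal.ofReal (a * b)
      = volume.prod volume (centeredInterval a ×ˢ centeredInterval b) := by
        rw [Measure.prod_prod, volume_centeredInterval, volume_centeredInterval,
          ENNReal.ofReal_mul ha]
    _ ≤ _ := (measure_mono hsub).trans (measure_union_le _ _)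
    _ ≤ _ := by
        gcongr
        refine (measure_union_le _ _).trans ?_
        rw [hN']
        refine (add_le_add hN hN).trans_eq ?_
        rw [← ENNReal.ofReal_add (by positivity) (by positivity)]
        congr 1
        ring

/-- The Riesz rearrangement inequality for bounded measurable subsets of the line. -/
lemma volume_sumTriple_le_centeredInterval {A B C : Set ℝ} {R : ℝ} (hA : MeasurableSet A)
    (hB : MeasurableSet B) (hC : MeasurableSet C) (hAR : A ⊆ Set.Icc (-R) R)
    (hBR : B ⊆ Set.Icc (-R) R) (hCR : C ⊆ Set.Icc (-R) R) :
    volume.prod volume (sumTriple A B C) ≤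
      volume.prod volume (sumTriple (centeredInterval (volume A).toReal)
        (centeredInterval (volume B).toReal) (centeredInterval (volume C).toReal)) := by
  rcases lt_or_ge R 0 with hR | hR
  · have : A = ∅ := Set.subset_empty_iff.1 (hAR.trans_eq (Set.Icc_eq_empty (by linarith)))
    simp [this, sumTriple]
  have hAf : volume A ≠ ⊤ := measure_ne_top_of_subset hAR (by simp)
  have hBf : volume B ≠ ⊤ := measure_ne_top_of_subset hBR (by simp)
  have hCf : volume C ≠ ⊤ := measure_ne_top_of_subset hCR (by simp)
  obtain ⟨a, ha⟩ : ∃ a, a = (volume A).toReal := ⟨_, rfl⟩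
  obtain ⟨b, hb⟩ : ∃ b, b = (volume B).toReal := ⟨_, rfl⟩
  obtain ⟨c, hc⟩ : ∃ c, c = (volume C).toReal := ⟨_, rfl⟩
  have ha' : volume A = ENNReal.ofReal a := by rw [ha, ENNReal.ofReal_toReal hAf]
  have hb' : volume B = ENNReal.ofReal b := by rw [hb, ENNReal.ofReal_toReal hBf]
  have hc' : volume C = ENNReal.ofReal c := by rw [hc, ENNReal.ofReal_toReal hCf]
  have ha0 : 0 ≤ a := ha ▸ ENNReal.toReal_nonneg
  have hb0 : 0 ≤ b := hb ▸ ENNReal.toReal_nonneg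
  have hc0 : 0 ≤ c := hc ▸ ENNReal.toReal_nonneg
  rw [← ha, ← hb, ← hc]
  have mI := measurableSet_centeredInterval
  rcases le_total (a + b) c with h1 | h1
  · refine (measure_sumTriple_le_mul volume A B C).trans ?_
    rw [ha', hb', ← volume_centeredInterval, ← volume_centeredInterval, ← Measure.prod_prod]
    refine measure_mono ?_
    rintro ⟨x, y⟩ ⟨hx, hy⟩
    refine ⟨hx, hy, ?_⟩
    simp only [centeredInterval, Set.mem_ofPred_eq] at *
    linarith [abs_add_le x y]
  rcases le_total (a + c) b with h2 | h2
  · refine (measure_sumTriple_le_mul_right volume B hA hC).trans ?_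
    rw [ha', hc', ← volume_centeredInterval, ← volume_centeredInterval c,
      ← measure_sumTriple_univ_mid volume (mI a) (mI c)]
    refine measure_mono ?_
    rintro ⟨x, y⟩ ⟨hx, -, hy⟩
    refine ⟨hx, ?_, hy⟩
    simp only [centeredInterval, Set.mem_ofPred_eq] at *
    have := abs_sub (x + y) x
    rw [add_sub_cancel_left] at this
    linarith
  rcases le_total (b + c) a with h3 | h3
  · rw [measure_sumTriple_swap volume hA hB hC, measure_sumTriple_swap volume (mI a) (mI b) (mI c)]
    refine (measure_sumTriple_le_mul_right volume A hB hC).trans ?_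
    rw [hb', hc', ← volume_centeredInterval, ← volume_centeredInterval c,
      ← measure_sumTriple_univ_mid volume (mI b) (mI c)]
    refine measure_mono ?_
    rintro ⟨x, y⟩ ⟨hx, -, hy⟩
    refine ⟨hx, ?_, hy⟩
    simp only [centeredInterval, Set.mem_ofPred_eq] at *
    have := abs_sub (x + y) x
    rw [add_sub_cancel_left] at this
    linarith
  obtain ⟨t, ht⟩ : ∃ t, t = (a + b - c) / 2 := ⟨_, rfl⟩
  have ht0 : 0 ≤ t := by linarith
  have hup := volume_sumTriple_le_truncation (t := t) hA hB hC hAR hBR hR ht0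
    (by rw [ha']; exact ENNReal.ofReal_le_ofReal (by linarith))
    (by rw [hb']; exact ENNReal.ofReal_le_ofReal (by linarith))
  have hlow := volume_sumTriple_centeredInterval_ge ha0 h1
  rw [← ht] at hlow
  rw [ha', hb', hc', ← ENNReal.ofReal_sub _ ht0, ← ENNReal.ofReal_sub _ ht0,
    ← ENNReal.ofReal_mul (by linarith), ← ENNReal.ofReal_mul hc0,
    ← ENNReal.ofReal_add (mul_nonneg (by linarith) (by linarith)) (mul_nonneg hc0 ht0)] at hup
  refine (ENNReal.add_le_add_iff_right (ENNReal.ofReal_ne_top (r := t ^ 2))).1 ?_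
  refine (add_le_add hup le_rfl).trans (le_trans (le_of_eq ?_) hlow)
  rw [← ENNReal.ofReal_add (add_nonneg (mul_nonneg (by linarith) (by linarith))
    (mul_nonneg hc0 ht0)) (sq_nonneg t)]
  congr 1
  have : c = a + b - 2 * t := by linarith
  rw [this]
  ring

section Steiner

variable {V : Type*} [NormedAddCommGroup V] [InnerProductSpace ℝ V]

/-- The slice of `A` along the line through `y` with direction `e`. -/
def lineSlice (e : V) (A : Set V) (y : V) : Set ℝ := {s | s • e + y ∈ A}

/-- The Steiner symmetrization of `A` in the direction of the unit vector `e`. -/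
def steinerSymm (e : V) (A : Set V) : Set V :=
  {x | ENNReal.ofReal (2 * |inner ℝ e x|) < volume (lineSlice e A (x - inner ℝ e x • e))}

lemma lineSlice_steinerSymm {e : V} {y : V} (he : ‖e‖ = 1) (hy : inner ℝ e y = 0)
    {A : Set V} (hA : volume (lineSlice e A y) ≠ ⊤) :
    lineSlice e (steinerSymm e A) y = centeredInterval (volume (lineSlice e A y)).toReal := by
  ext s
  have h1 : inner ℝ e (s • e + y) = s := by
    rw [inner_add_right, inner_smul_right, real_inner_self_eq_norm_sq, he, hy]
    ring
  simp only [lineSlice, steinerSymm, centeredInterval, Set.mem_ofPred_eq, h1, add_sub_cancel_left]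
  exact ENNReal.ofReal_lt_iff_lt_toReal (by positivity) hA

lemma exists_lineSlice_ball {e y : V} (he : ‖e‖ = 1) (hy : inner ℝ e y = 0) {r : ℝ}
    (hr : 0 ≤ r) : ∃ b, 0 ≤ b ∧ lineSlice e (Metric.ball 0 r) y = centeredInterval b := by
  refine ⟨2 * √(r ^ 2 - ‖y‖ ^ 2), by positivity, ?_⟩
  ext s
  have h1 : ‖s • e + y‖ ^ 2 = s ^ 2 + ‖y‖ ^ 2 := by
    rw [norm_add_sq_real, inner_smul_left, hy, norm_smul, he, Real.norm_eq_abs, mul_one, sq_abs]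
    simp
  simp only [lineSlice, centeredInterval, Set.mem_ofPred_eq, mem_ball_zero_iff]
  rw [mul_lt_mul_iff_right₀ two_pos, Real.lt_sqrt (abs_nonneg s), sq_abs,
    ← pow_lt_pow_iff_left₀ (norm_nonneg _) hr two_ne_zero, h1]
  constructor <;> intro h <;> linarith

lemma centeredInterval_inter (a b : ℝ) :
    centeredInterval a ∩ centeredInterval b = centeredInterval (min a b) := by
  ext s
  simp [centeredInterval]

lemma volume_slice_gain {a : Set ℝ} {b τ : ℝ} (ha : MeasurableSet a) (haf : volume a ≠ ⊤) :
    volume (a ∩ centeredInterval b) +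
        volume {s | s ∈ a \ centeredInterval b ∧ s + τ ∈ centeredInterval b \ a} ≤
      volume (centeredInterval (volume a).toReal ∩ centeredInterval b) := by
  rw [centeredInterval_inter, volume_centeredInterval, ENNReal.ofReal_min,
    ENNReal.ofReal_toReal haf, ← volume_centeredInterval, le_min_iff]
  have hm := measurableSet_centeredInterval b
  constructor
  · rw [← measure_inter_add_sdiff a hm]
    gcongr
    exact fun s hs => hs.1
  · rw [← measure_inter_add_sdiff (centeredInterval b) ha, Set.inter_comm a]
    refine add_le_add le_rfl ?_
    rw [← measure_preimage_add_right volume τ (centeredInterval b \ a)]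
    exact measure_mono fun s hs => hs.2

variable [MeasurableSpace V] [BorelSpace V]

lemma measurableSet_lineSlice (e : V) {A : Set V} (hA : MeasurableSet A) (y : V) :
    MeasurableSet (lineSlice e A y) :=
  (by fun_prop : Measurable fun s : ℝ => s • e + y) hA

variable [FiniteDimensional ℝ V]

lemma measurableSet_steinerSymm (e : V) {A : Set V} (hA : MeasurableSet A) :
    MeasurableSet (steinerSymm e A) := by
  have h1 : Measurable fun p : V × ℝ => p.2 • e + (p.1 - inner ℝ e p.1 • e) := by fun_prop
  exact measurableSet_lt (by fun_prop) (measurable_measure_prodMk_left (ν := volume) (h1 hA))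

lemma exists_measurePreserving_line_prod (μ : Measure V) [μ.IsAddHaarMeasure] {e : V}
    (he : e ≠ 0) : ∃ ν : Measure (ℝ ∙ e)ᗮ, SFinite ν ∧
      MeasurePreserving (fun p : ℝ × (ℝ ∙ e)ᗮ => p.1 • e + (p.2 : V)) (volume.prod ν) μ := by
  let L : (ℝ × (ℝ ∙ e)ᗮ) ≃ₗ[ℝ] V :=
    ((LinearEquiv.toSpanNonzeroSingleton ℝ V e he).prodCongr (LinearEquiv.refl ℝ (ℝ ∙ e)ᗮ)).trans
      (Submodule.prodEquivOfIsCompl (ℝ ∙ e) (ℝ ∙ e)ᗮ (Submodule.isCompl_orthogonal _))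
  let L' := L.toContinuousLinearEquiv
  let μ' := Measure.map L' ((volume : Measure ℝ).prod (Measure.addHaar : Measure (ℝ ∙ e)ᗮ))
  have hμ' : μ'.IsAddHaarMeasure := L'.isAddHaarMeasure_map _
  have hc := Measure.isAddLeftInvariant_eq_smul μ μ'
  set c := Measure.addHaarScalarFactor μ μ'
  refine ⟨c • Measure.addHaar, inferInstance, ?_, ?_⟩
  · fun_prop
  · rw [Measure.prod_smul_right, Measure.map_smul, hc]
    rfl

variable {μ : Measure V} {e : V} {ν : Measure (ℝ ∙ e)ᗮ} [SFinite ν]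

omit [BorelSpace V] [FiniteDimensional ℝ V] in
lemma measure_eq_lintegral_lineSlice
    (hν : MeasurePreserving (fun p : ℝ × (ℝ ∙ e)ᗮ => p.1 • e + (p.2 : V)) (volume.prod ν) μ)
    {A : Set V} (hA : MeasurableSet A) :
    μ A = ∫⁻ y, volume (lineSlice e A (y : V)) ∂ν := by
  rw [← hν.measure_preimage hA.nullMeasurableSet, Measure.prod_apply_symm (hν.measurable hA)]
  rfl

lemma measure_sumTriple_eq_lintegral_lineSlice [SFinite μ]
    (hν : MeasurePreserving (fun p : ℝ × (ℝ ∙ e)ᗮ => p.1 • e + (p.2 : V)) (volume.prod ν) μ)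
    {A B C : Set V} (hA : MeasurableSet A) (hB : MeasurableSet B) (hC : MeasurableSet C) :
    μ.prod μ (sumTriple A B C) = ∫⁻ y, ∫⁻ y', volume.prod volume
      (sumTriple (lineSlice e A (y : V)) (lineSlice e B (y' : V))
        (lineSlice e C ((y : V) + y'))) ∂ν ∂ν := by
  have hS := measurableSet_sumTriple hA hB hC
  have hm : Measurable fun q : (ℝ × (ℝ ∙ e)ᗮ) × (ℝ × (ℝ ∙ e)ᗮ) =>
      (q.1.1 • e + (q.1.2 : V), q.2.1 • e + (q.2.2 : V)) := by fun_prop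
  have hT := hm hS
  have hpre : ((volume.prod ν).prod (volume.prod ν)) ((fun q : (ℝ × (ℝ ∙ e)ᗮ) × (ℝ × (ℝ ∙ e)ᗮ) =>
      (q.1.1 • e + (q.1.2 : V), q.2.1 • e + (q.2.2 : V))) ⁻¹' sumTriple A B C) =
      μ.prod μ (sumTriple A B C) := (hν.prod hν).measure_preimage hS.nullMeasurableSet
  rw [← hpre, Measure.prod_apply hT, lintegral_prod_symm _
    (measurable_measure_prodMk_left hT).aemeasurable]
  refine lintegral_congr fun y => ?_
  have h1 : ∀ s : ℝ, (volume.prod ν) (Prod.mk (s, y) ⁻¹'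
      ((fun q : (ℝ × (ℝ ∙ e)ᗮ) × (ℝ × (ℝ ∙ e)ᗮ) =>
      (q.1.1 • e + (q.1.2 : V), q.2.1 • e + (q.2.2 : V))) ⁻¹' sumTriple A B C)) =
      ∫⁻ y', volume {s' : ℝ | (s • e + (y : V), s' • e + (y' : V)) ∈ sumTriple A B C} ∂ν := by
    intro s
    rw [Measure.prod_apply_symm (measurable_prodMk_left hT)]
    rfl
  refine (lintegral_congr h1).trans ?_
  rw [lintegral_lintegral_swap]
  · refine lintegral_congr fun y' => ?_
    rw [Measure.prod_apply (measurableSet_sumTriple (measurableSet_lineSlice e hA y)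
      (measurableSet_lineSlice e hB y') (measurableSet_lineSlice e hC _))]
    refine lintegral_congr fun s => ?_
    congr 1
    ext s'
    simp only [sumTriple, lineSlice, Set.mem_ofPred_eq, Set.mem_preimage]
    rw [show s • e + (y : V) + (s' • e + (y' : V)) = (s + s') • e + ((y : V) + y') by
      rw [add_smul]; abel]
  · have h2 : Measurable fun q : (ℝ × (ℝ ∙ e)ᗮ) × ℝ =>
        (q.1.1 • e + (y : V), q.2 • e + (q.1.2 : V)) := by fun_prop
    exact (measurable_measure_prodMk_left (ν := volume) (h2 hS)).aemeasurable

omit [MeasurableSpace V] [BorelSpace V] [FiniteDimensional ℝ V] in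
lemma lineSlice_subset_Icc {A : Set V} {R : ℝ} (he : ‖e‖ = 1) (hAR : A ⊆ Metric.ball 0 R)
    (y : (ℝ ∙ e)ᗮ) : lineSlice e A (y : V) ⊆ Set.Icc (-R) R := by
  intro s hs
  have h1 := hAR hs
  rw [mem_ball_zero_iff] at h1
  have h2 := abs_real_inner_le_norm e (s • e + (y : V))
  rw [inner_add_right, inner_smul_right, real_inner_self_eq_norm_sq, he,
    (Submodule.mem_orthogonal_singleton_iff_inner_right).1 y.2] at h2
  simp only [one_pow, mul_one, add_zero, one_mul] at h2
  exact abs_le.1 (by linarith)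

omit [FiniteDimensional ℝ V] [MeasurableSpace V] [BorelSpace V] in
lemma volume_lineSlice_ne_top {A : Set V} {R : ℝ} (he : ‖e‖ = 1) (hAR : A ⊆ Metric.ball 0 R)
    (y : (ℝ ∙ e)ᗮ) : volume (lineSlice e A (y : V)) ≠ ⊤ :=
  measure_ne_top_of_subset (lineSlice_subset_Icc he hAR y) (by simp)

omit [FiniteDimensional ℝ V] [MeasurableSpace V] [BorelSpace V] in
lemma inner_coe_orthogonal_span (y : (ℝ ∙ e)ᗮ) : inner ℝ e (y : V) = 0 :=
  (Submodule.mem_orthogonal_singleton_iff_inner_right).1 y.2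

lemma measure_steinerSymm
    (hν : MeasurePreserving (fun p : ℝ × (ℝ ∙ e)ᗮ => p.1 • e + (p.2 : V)) (volume.prod ν) μ)
    (he : ‖e‖ = 1) {A : Set V} {R : ℝ} (hA : MeasurableSet A) (hAR : A ⊆ Metric.ball 0 R) :
    μ (steinerSymm e A) = μ A := by
  rw [measure_eq_lintegral_lineSlice hν (measurableSet_steinerSymm e hA),
    measure_eq_lintegral_lineSlice hν hA]
  refine lintegral_congr fun y => ?_
  have hf := volume_lineSlice_ne_top he hAR y
  rw [lineSlice_steinerSymm he (inner_coe_orthogonal_span y) hf, volume_centeredInterval,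
    ENNReal.ofReal_toReal hf]

omit [MeasurableSpace V] [BorelSpace V] [FiniteDimensional ℝ V] in
lemma steinerSymm_subset_ball (he : ‖e‖ = 1) {A : Set V} {R : ℝ} (hR : 0 ≤ R)
    (hAR : A ⊆ Metric.ball 0 R) : steinerSymm e A ⊆ Metric.ball 0 R := by
  intro x hx
  have hy : inner ℝ e (x - inner ℝ e x • e) = 0 := by
    rw [inner_sub_right, inner_smul_right, real_inner_self_eq_norm_sq, he]
    ring
  obtain ⟨b, hb, hbs⟩ := exists_lineSlice_ball he hy hR
  have h1 : volume (lineSlice e A (x - inner ℝ e x • e)) ≤ ENNReal.ofReal b := by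
    rw [← volume_centeredInterval, ← hbs]
    exact measure_mono fun s hs => hAR hs
  have h2 : inner ℝ e x ∈ centeredInterval b :=
    (ENNReal.ofReal_lt_ofReal_iff_of_nonneg (by positivity)).1 (lt_of_lt_of_le hx h1)
  rw [← hbs] at h2
  simpa [lineSlice] using h2

lemma measure_sumTriple_le_steinerSymm [SFinite μ]
    (hν : MeasurePreserving (fun p : ℝ × (ℝ ∙ e)ᗮ => p.1 • e + (p.2 : V)) (volume.prod ν) μ)
    (he : ‖e‖ = 1) {A B C : Set V} {R : ℝ} (hA : MeasurableSet A) (hB : MeasurableSet B)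
    (hC : MeasurableSet C) (hAR : A ⊆ Metric.ball 0 R) (hBR : B ⊆ Metric.ball 0 R)
    (hCR : C ⊆ Metric.ball 0 R) :
    μ.prod μ (sumTriple A B C) ≤
      μ.prod μ (sumTriple (steinerSymm e A) (steinerSymm e B) (steinerSymm e C)) := by
  rw [measure_sumTriple_eq_lintegral_lineSlice hν hA hB hC,
    measure_sumTriple_eq_lintegral_lineSlice hν (measurableSet_steinerSymm e hA)
      (measurableSet_steinerSymm e hB) (measurableSet_steinerSymm e hC)]
  refine lintegral_mono fun y => lintegral_mono fun y' => ?_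
  simp only [← Submodule.coe_add]
  rw [lineSlice_steinerSymm he (inner_coe_orthogonal_span y) (volume_lineSlice_ne_top he hAR y),
    lineSlice_steinerSymm he (inner_coe_orthogonal_span y') (volume_lineSlice_ne_top he hBR y'),
    lineSlice_steinerSymm he (inner_coe_orthogonal_span (y + y'))
      (volume_lineSlice_ne_top he hCR (y + y'))]
  exact volume_sumTriple_le_centeredInterval (measurableSet_lineSlice e hA y)
    (measurableSet_lineSlice e hB y') (measurableSet_lineSlice e hC _)
    (lineSlice_subset_Icc he hAR y) (lineSlice_subset_Icc he hBR y')
    (lineSlice_subset_Icc he hCR (y + y'))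

lemma measure_inter_ball_add_le_steinerSymm
    (hν : MeasurePreserving (fun p : ℝ × (ℝ ∙ e)ᗮ => p.1 • e + (p.2 : V)) (volume.prod ν) μ)
    (he : ‖e‖ = 1) {A : Set V} {R r : ℝ} (hA : MeasurableSet A) (hAR : A ⊆ Metric.ball 0 R)
    (hr : 0 ≤ r) (τ : ℝ) :
    μ (A ∩ Metric.ball 0 r) +
        μ {x | x ∈ A \ Metric.ball 0 r ∧ x + τ • e ∈ Metric.ball 0 r \ A} ≤
      μ (steinerSymm e A ∩ Metric.ball 0 r) := by
  have hb : MeasurableSet (Metric.ball (0 : V) r) := measurableSet_ball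
  have hm : MeasurableSet {x | x ∈ A \ Metric.ball 0 r ∧ x + τ • e ∈ Metric.ball 0 r \ A} :=
    (hA.diff hb).inter ((measurable_add_const (τ • e)) (hb.diff hA))
  rw [measure_eq_lintegral_lineSlice hν (hA.inter hb), measure_eq_lintegral_lineSlice hν hm,
    measure_eq_lintegral_lineSlice hν ((measurableSet_steinerSymm e hA).inter hb),
    ← lintegral_add_left]
  · refine lintegral_mono fun y => ?_
    obtain ⟨b, -, hbs⟩ := exists_lineSlice_ball he (inner_coe_orthogonal_span y) hr
    have hf := volume_lineSlice_ne_top he hAR y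
    have key := volume_slice_gain (b := b) (τ := τ) (measurableSet_lineSlice e hA y) hf
    rw [← lineSlice_steinerSymm he (inner_coe_orthogonal_span y) hf, ← hbs] at key
    refine le_trans (le_of_eq ?_) key
    congr 2
    ext s
    simp only [lineSlice, Set.mem_ofPred_eq, Set.mem_sdiff]
    rw [show s • e + (y : V) + τ • e = (s + τ) • e + y by rw [add_smul]; abel]
  · have h2 : Measurable fun q : (ℝ ∙ e)ᗮ × ℝ => q.2 • e + (q.1 : V) := by fun_prop
    exact measurable_measure_prodMk_left (ν := volume) (h2 (hA.inter hb))

end Steiner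

section Riesz

variable {V : Type*} [NormedAddCommGroup V] [InnerProductSpace ℝ V] [MeasurableSpace V]
  [BorelSpace V] [FiniteDimensional ℝ V]

lemma measure_mul_le_of_forall_translate_le (μ : Measure V) [μ.IsAddHaarMeasure] {D E : Set V}
    {R : ℝ} (hD : MeasurableSet D) (hE : MeasurableSet E) (hDR : D ⊆ Metric.ball 0 R)
    (hER : E ⊆ Metric.ball 0 R) {g : ℝ≥0∞} (hg : ∀ z, μ {x | x ∈ D ∧ x + z ∈ E} ≤ g) :
    μ D * μ E ≤ g * μ (Metric.ball 0 (2 * R)) := by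
  rw [← measure_sumTriple_univ_mid μ hD hE,
    Measure.prod_apply_symm (measurableSet_sumTriple hD .univ hE), ← setLIntegral_const,
    ← lintegral_indicator measurableSet_ball]
  refine lintegral_mono fun z => ?_
  by_cases hz : z ∈ Metric.ball (0 : V) (2 * R)
  · rw [Set.indicator_of_mem hz]
    refine (measure_mono ?_).trans (hg z)
    exact fun x hx => ⟨hx.1, hx.2.2⟩
  · rw [Set.indicator_of_notMem hz]
    refine le_of_eq ?_
    convert measure_empty (μ := μ)
    ext x
    simp only [sumTriple, Set.mem_preimage, Set.mem_ofPred_eq, Set.mem_empty_iff_false, iff_false]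
    rintro ⟨hx, -, hxz⟩
    refine hz ?_
    have h1 := hDR hx
    have h2 := hER hxz
    rw [mem_ball_zero_iff] at *
    have h3 := norm_sub_le (x + z) x
    rw [add_sub_cancel_left] at h3
    linarith

lemma exists_translate_measure_ge (μ : Measure V) [μ.IsAddHaarMeasure] {D E : Set V}
    {R : ℝ} (hD : MeasurableSet D) (hE : MeasurableSet E) (hDR : D ⊆ Metric.ball 0 R)
    (hER : E ⊆ Metric.ball 0 R) {ε : ℝ≥0∞} (hε : ε ≠ 0) (hεD : ε ≤ μ D) (hεE : ε ≤ μ E) :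
    ∃ z, ε * ε / 2 / μ (Metric.ball 0 (2 * R)) ≤ μ {x | x ∈ D ∧ x + z ∈ E} := by
  by_contra! h
  have hDf : μ D ≠ ⊤ := measure_ne_top_of_subset hDR measure_ball_lt_top.ne
  have hεf : ε * ε ≠ ⊤ := by
    have := ne_top_of_le_ne_top hDf hεD
    exact ENNReal.mul_ne_top this this
  have h1 := measure_mul_le_of_forall_translate_le μ hD hE hDR hER fun z => (h z).le
  have h2 : ε * ε ≤ ε * ε / 2 :=
    (mul_le_mul' hεD hεE).trans (h1.trans (ENNReal.mul_le_of_le_div le_rfl))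
  exact absurd h2 (not_le.2 (ENNReal.half_lt_self (mul_ne_zero hε hε) hεf))

/-- A triple of measurable subsets of a ball, with the measures of the balls of radii `r i`,
for which the Riesz functional is at least `c`. -/
structure RieszTriple (μ : Measure V) (R : ℝ) (r : Fin 3 → ℝ) (c : ℝ≥0∞) (A : Fin 3 → Set V) :
    Prop where
  measurableSet : ∀ i, MeasurableSet (A i)
  subset : ∀ i, A i ⊆ Metric.ball 0 R
  measure_eq : ∀ i, μ (A i) = μ (Metric.ball 0 (r i))
  le : c ≤ μ.prod μ (sumTriple (A 0) (A 1) (A 2))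

lemma RieszTriple.exists_gain {μ : Measure V} [μ.IsAddHaarMeasure] {R : ℝ} {r : Fin 3 → ℝ}
    {c : ℝ≥0∞} {A : Fin 3 → Set V} (hA : RieszTriple μ R r c A) (hR : 0 ≤ R) (hr : ∀ i, 0 ≤ r i)
    (hrR : ∀ i, r i ≤ R) {ε : ℝ≥0∞} (hε : ε ≠ 0) {i : Fin 3}
    (hi : ε ≤ μ (A i \ Metric.ball 0 (r i))) :
    ∃ A', RieszTriple μ R r c A' ∧
      (∑ j, μ (A j ∩ Metric.ball 0 (r j))) + ε * ε / 2 / μ (Metric.ball 0 (2 * R)) ≤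
        ∑ j, μ (A' j ∩ Metric.ball 0 (r j)) := by
  have hb : MeasurableSet (Metric.ball (0 : V) (r i)) := measurableSet_ball
  have hball : μ (Metric.ball 0 (r i)) ≠ ⊤ := measure_ball_lt_top.ne
  have hsymm : μ (Metric.ball 0 (r i) \ A i) = μ (A i \ Metric.ball 0 (r i)) := by
    have h1 := measure_inter_add_sdiff (μ := μ) (A i) hb
    have h2 := measure_inter_add_sdiff (μ := μ) (Metric.ball 0 (r i)) (hA.measurableSet i)
    rw [hA.measure_eq i, ← h2, Set.inter_comm] at h1
    exact ((ENNReal.add_right_inj (measure_ne_top_of_subset Set.inter_subset_left hball)).1 h1).symm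
  obtain ⟨z, hz⟩ := exists_translate_measure_ge μ ((hA.measurableSet i).diff hb)
    (hb.diff (hA.measurableSet i)) (Set.sdiff_subset.trans (hA.subset i))
    (Set.sdiff_subset.trans (Metric.ball_subset_ball (hrR i))) hε hi (hsymm ▸ hi)
  have hpos : ε * ε / 2 / μ (Metric.ball 0 (2 * R)) ≠ 0 :=
    (ENNReal.div_pos (ENNReal.div_pos (mul_ne_zero hε hε) (by simp)).ne'
      measure_ball_lt_top.ne).ne'
  have hz0 : z ≠ 0 := by
    rintro rfl
    refine hpos (le_zero_iff.1 (hz.trans_eq ?_))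
    convert measure_empty (μ := μ)
    ext x
    simp only [add_zero, Set.mem_sdiff, Set.mem_ofPred_eq, Set.mem_empty_iff_false, iff_false]
    tauto
  have hz1 : ‖z‖ ≠ 0 := norm_ne_zero_iff.2 hz0
  set e := ‖z‖⁻¹ • z with he_def
  have he : ‖e‖ = 1 := by
    rw [he_def, norm_smul, norm_inv, norm_norm, inv_mul_cancel₀ hz1]
  have hez : ‖z‖ • e = z := by rw [he_def, smul_smul, mul_inv_cancel₀ hz1, one_smul]
  obtain ⟨ν, hνf, hν⟩ := exists_measurePreserving_line_prod μ (e := e)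
    (by rw [← norm_ne_zero_iff, he]; exact one_ne_zero)
  refine ⟨fun j => steinerSymm e (A j), ⟨fun j => measurableSet_steinerSymm e (hA.measurableSet j),
    fun j => steinerSymm_subset_ball he hR (hA.subset j),
    fun j => by rw [measure_steinerSymm hν he (hA.measurableSet j) (hA.subset j), hA.measure_eq],
    hA.le.trans (measure_sumTriple_le_steinerSymm hν he (hA.measurableSet 0) (hA.measurableSet 1)
      (hA.measurableSet 2) (hA.subset 0) (hA.subset 1) (hA.subset 2))⟩, ?_⟩
  have hgain := fun j => measure_inter_ball_add_le_steinerSymm hν he (hA.measurableSet j)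
    (hA.subset j) (hr j) ‖z‖
  rw [← Finset.add_sum_erase _ _ (Finset.mem_univ i),
    ← Finset.add_sum_erase Finset.univ (fun j => μ (steinerSymm e (A j) ∩ _)) (Finset.mem_univ i),
    add_right_comm]
  refine add_le_add (le_trans ?_ (hgain i)) (Finset.sum_le_sum fun j _ =>
    le_self_add.trans (hgain j))
  rw [hez]
  gcongr

lemma RieszTriple.exists_near_ball {μ : Measure V} [μ.IsAddHaarMeasure] {R : ℝ} {r : Fin 3 → ℝ}
    {c : ℝ≥0∞} {A : Fin 3 → Set V} (hA : RieszTriple μ R r c A) (hR : 0 ≤ R) (hr : ∀ i, 0 ≤ r i)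
    (hrR : ∀ i, r i ≤ R) {ε : ℝ≥0∞} (hε : ε ≠ 0) :
    ∃ A', RieszTriple μ R r c A' ∧ ∀ i, μ (A' i \ Metric.ball 0 (r i)) ≤ ε := by
  by_contra! h
  set g := ε * ε / 2 / μ (Metric.ball 0 (2 * R)) with hg
  have hpos : g ≠ 0 :=
    (ENNReal.div_pos (ENNReal.div_pos (mul_ne_zero hε hε) (by simp)).ne'
      measure_ball_lt_top.ne).ne'
  have hiter : ∀ n : ℕ, ∃ A', RieszTriple μ R r c A' ∧
      n * g ≤ ∑ j, μ (A' j ∩ Metric.ball 0 (r j)) := by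
    intro n
    induction n with
    | zero => exact ⟨A, hA, by simp⟩
    | succ n ih =>
      obtain ⟨B, hB, hBn⟩ := ih
      obtain ⟨i, hi⟩ := h B hB
      obtain ⟨B', hB', hBB'⟩ := hB.exists_gain hR hr hrR hε hi.le
      refine ⟨B', hB', le_trans ?_ hBB'⟩
      rw [Nat.cast_succ, add_mul, one_mul]
      gcongr
  have hfin : ∑ j : Fin 3, μ (Metric.ball 0 (r j)) ≠ ⊤ :=
    (ENNReal.sum_lt_top.2 fun j _ => measure_ball_lt_top).ne
  obtain ⟨n, hn⟩ := ENNReal.exists_nat_mul_gt hpos hfin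
  obtain ⟨B, -, hBn⟩ := hiter n
  exact absurd (hn.trans_le (hBn.trans (Finset.sum_le_sum fun j _ =>
    measure_mono Set.inter_subset_right))) (lt_irrefl _)

lemma measure_sumTriple_le_add_sdiff (μ : Measure V) [μ.IsAddHaarMeasure] {A B C A' B' C' : Set V}
    (hA : MeasurableSet A) (hC : MeasurableSet C) (hC' : MeasurableSet C') :
    μ.prod μ (sumTriple A B C) ≤ μ.prod μ (sumTriple A' B' C') +
      (μ (A \ A') * μ B + μ A * μ (B \ B') + μ A * μ (C \ C')) := by
  have hsub : sumTriple A B C ⊆ sumTriple A' B' C' ∪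
      ((sumTriple (A \ A') B C ∪ sumTriple A (B \ B') C) ∪ sumTriple A B (C \ C')) := by
    rintro ⟨x, y⟩ ⟨hx, hy, hxy⟩
    simp only [sumTriple, Set.mem_union, Set.mem_ofPred_eq, Set.mem_sdiff] at *
    tauto
  refine (measure_mono hsub).trans ((measure_union_le _ _).trans (add_le_add le_rfl
    ((measure_union_le _ _).trans
      (add_le_add ((measure_union_le _ _).trans (add_le_add ?_ ?_)) ?_))))
  · exact measure_sumTriple_le_mul μ _ _ _
  · exact measure_sumTriple_le_mul μ _ _ _
  · exact measure_sumTriple_le_mul_right μ _ hA (hC.diff hC')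

/-- The Riesz rearrangement inequality for bounded measurable sets. -/
lemma measure_sumTriple_le_ball_of_bounded (μ : Measure V) [μ.IsAddHaarMeasure] {A B C : Set V}
    {R a b c : ℝ} (hA : MeasurableSet A) (hB : MeasurableSet B) (hC : MeasurableSet C)
    (hAR : A ⊆ Metric.ball 0 R) (hBR : B ⊆ Metric.ball 0 R) (hCR : C ⊆ Metric.ball 0 R)
    (ha : 0 ≤ a) (hb : 0 ≤ b) (hc : 0 ≤ c) (hAa : μ A = μ (Metric.ball 0 a))
    (hBb : μ B = μ (Metric.ball 0 b)) (hCc : μ C = μ (Metric.ball 0 c)) :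
    μ.prod μ (sumTriple A B C) ≤
      μ.prod μ (sumTriple (Metric.ball 0 a) (Metric.ball 0 b) (Metric.ball 0 c)) := by
  set R' := max R (max a (max b c))
  have hRR' : Metric.ball (0 : V) R ⊆ Metric.ball 0 R' := Metric.ball_subset_ball (le_max_left _ _)
  have hT : RieszTriple μ R' ![a, b, c] (μ.prod μ (sumTriple A B C)) ![A, B, C] := by
    refine ⟨fun i => ?_, fun i => ?_, fun i => ?_, le_rfl⟩ <;> fin_cases i
    exacts [hA, hB, hC, hAR.trans hRR', hBR.trans hRR', hCR.trans hRR', hAa, hBb, hCc]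
  refine ENNReal.le_of_forall_pos_le_add fun η hη _ => ?_
  set T : ℝ≥0∞ := μ (Metric.ball 0 b) + μ (Metric.ball 0 a) + μ (Metric.ball 0 a) + 1 with hTdef
  have hTf : T ≠ ⊤ := by
    simp only [hTdef, ne_eq, ENNReal.add_eq_top, not_or]
    exact ⟨⟨⟨measure_ball_lt_top.ne, measure_ball_lt_top.ne⟩, measure_ball_lt_top.ne⟩, by simp⟩
  obtain ⟨A', hA', hA'ε⟩ := hT.exists_near_ball (by simp [R', ha])
    (fun i => by fin_cases i; exacts [ha, hb, hc])
    (fun i => by fin_cases i <;> simp [R']) (ε := η / T)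
    (ENNReal.div_pos (by simpa using hη.ne') hTf).ne'
  refine hA'.le.trans ((measure_sumTriple_le_add_sdiff μ (A' := Metric.ball 0 a)
    (B' := Metric.ball 0 b) (C' := Metric.ball 0 c) (hA'.measurableSet 0) (hA'.measurableSet 2)
    measurableSet_ball).trans (add_le_add le_rfl ?_))
  have h0 : μ (A' 0) = μ (Metric.ball 0 a) := hA'.measure_eq 0
  have h1 : μ (A' 1) = μ (Metric.ball 0 b) := hA'.measure_eq 1
  have e0 : μ (A' 0 \ Metric.ball 0 a) ≤ η / T := hA'ε 0
  have e1 : μ (A' 1 \ Metric.ball 0 b) ≤ η / T := hA'ε 1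
  have e2 : μ (A' 2 \ Metric.ball 0 c) ≤ η / T := hA'ε 2
  rw [h0, h1]
  calc _ ≤ η / T * μ (Metric.ball 0 b) + μ (Metric.ball 0 a) * (η / T) +
        μ (Metric.ball 0 a) * (η / T) := by gcongr
    _ = η / T * (μ (Metric.ball 0 b) + μ (Metric.ball 0 a) + μ (Metric.ball 0 a)) := by ring
    _ ≤ η / T * T := by gcongr; exact le_self_add
    _ ≤ η := ENNReal.mul_le_of_le_div le_rfl

end Riesz

section BallStar

variable {d : ℕ}

lemma symmRadius_nonneg (A : Set (EuclideanSpace ℝ (Fin d))) : 0 ≤ symmRadius A :=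
  Real.rpow_nonneg ENNReal.toReal_nonneg _

lemma measurableSet_ballStar (A : Set (EuclideanSpace ℝ (Fin d))) : MeasurableSet (ballStar A) :=
  Metric.isOpen_ball.measurableSet

lemma volume_ballStar (hd : 1 ≤ d) {A : Set (EuclideanSpace ℝ (Fin d))} (hA : volume A ≠ ⊤) :
    volume (ballStar A) = volume A := by
  have : Nonempty (Fin d) := ⟨⟨0, hd⟩⟩
  have h1 : volume (Metric.ball (0 : EuclideanSpace ℝ (Fin d)) 1) ≠ 0 :=
    (Metric.measure_ball_pos _ _ one_pos).ne'
  have h2 : volume (Metric.ball (0 : EuclideanSpace ℝ (Fin d)) 1) ≠ ⊤ := measure_ball_lt_top.ne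
  have hd0 : (d : ℝ) ≠ 0 := by positivity
  rw [ballStar, Measure.addHaar_ball _ _ (symmRadius_nonneg A), finrank_euclideanSpace_fin,
    symmRadius, ← Real.rpow_natCast, ← Real.rpow_mul ENNReal.toReal_nonneg,
    one_div_mul_cancel hd0, Real.rpow_one, ENNReal.ofReal_toReal (ENNReal.div_ne_top hA h1),
    ENNReal.div_mul_cancel h1 h2]

lemma symmRadius_mono {A B : Set (EuclideanSpace ℝ (Fin d))} (hAB : volume A ≤ volume B)
    (hB : volume B ≠ ⊤) : symmRadius A ≤ symmRadius B := by
  have h1 : volume (Metric.ball (0 : EuclideanSpace ℝ (Fin d)) 1) ≠ 0 :=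
    (Metric.measure_ball_pos _ _ one_pos).ne'
  refine Real.rpow_le_rpow ENNReal.toReal_nonneg
    (ENNReal.toReal_mono (ENNReal.div_ne_top hB h1) ?_) (by positivity)
  gcongr

lemma ballStar_mono {A B : Set (EuclideanSpace ℝ (Fin d))} (hAB : volume A ≤ volume B)
    (hB : volume B ≠ ⊤) : ballStar A ⊆ ballStar B :=
  Metric.ball_subset_ball (symmRadius_mono hAB hB)

theorem measure_sumTriple_le_ballStar (hd : 1 ≤ d) {A B C : Set (EuclideanSpace ℝ (Fin d))}
    (hA : MeasurableSet A) (hB : MeasurableSet B) (hC : MeasurableSet C)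
    (hA' : volume A ≠ ⊤) (hB' : volume B ≠ ⊤) (hC' : volume C ≠ ⊤) :
    volume (sumTriple A B C) ≤ volume (sumTriple (ballStar A) (ballStar B) (ballStar C)) := by
  let U : ℕ → Set (EuclideanSpace ℝ (Fin d)) := fun n => Metric.ball 0 n
  have hU : Monotone U := fun m n h => Metric.ball_subset_ball (by exact_mod_cast h)
  have hUn : ⋃ n, U n = Set.univ := by
    refine Set.eq_univ_of_forall fun x => ?_
    obtain ⟨n, hn⟩ := exists_nat_gt ‖x‖
    exact Set.mem_iUnion.2 ⟨n, by simpa [U] using hn⟩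
  have hex : sumTriple A B C = ⋃ n, sumTriple (A ∩ U n) (B ∩ U n) (C ∩ U n) := by
    refine Set.Subset.antisymm (fun p hp => ?_) (Set.iUnion_subset fun n =>
      sumTriple_mono Set.inter_subset_left Set.inter_subset_left Set.inter_subset_left)
    obtain ⟨n₁, h₁⟩ := Set.mem_iUnion.1 (hUn ▸ Set.mem_univ p.1)
    obtain ⟨n₂, h₂⟩ := Set.mem_iUnion.1 (hUn ▸ Set.mem_univ p.2)
    obtain ⟨n₃, h₃⟩ := Set.mem_iUnion.1 (hUn ▸ Set.mem_univ (p.1 + p.2))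
    refine Set.mem_iUnion.2 ⟨max n₁ (max n₂ n₃), ⟨hp.1, hU (le_max_left _ _) h₁⟩,
      ⟨hp.2.1, hU ((le_max_left _ _).trans (le_max_right _ _)) h₂⟩,
      ⟨hp.2.2, hU ((le_max_right _ _).trans (le_max_right _ _)) h₃⟩⟩
  have hmono : Monotone fun n => sumTriple (A ∩ U n) (B ∩ U n) (C ∩ U n) := fun m n h =>
    sumTriple_mono (Set.inter_subset_inter_right _ (hU h)) (Set.inter_subset_inter_right _ (hU h))
      (Set.inter_subset_inter_right _ (hU h))
  rw [hex, hmono.measure_iUnion]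
  refine iSup_le fun n => ?_
  have hUm : MeasurableSet (U n) := Metric.isOpen_ball.measurableSet
  have fin : ∀ {S : Set (EuclideanSpace ℝ (Fin d))}, volume S ≠ ⊤ → volume (S ∩ U n) ≠ ⊤ :=
    fun h => ne_top_of_le_ne_top h (measure_mono Set.inter_subset_left)
  have key := measure_sumTriple_le_ball_of_bounded (volume : Measure (EuclideanSpace ℝ (Fin d)))
    (hA.inter hUm) (hB.inter hUm) (hC.inter hUm) (R := n) Set.inter_subset_right
    Set.inter_subset_right Set.inter_subset_right (symmRadius_nonneg _) (symmRadius_nonneg _)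
    (symmRadius_nonneg _) (volume_ballStar hd (fin hA')).symm (volume_ballStar hd (fin hB')).symm
    (volume_ballStar hd (fin hC')).symm
  refine key.trans (measure_mono (sumTriple_mono ?_ ?_ ?_))
  · exact ballStar_mono (measure_mono Set.inter_subset_left) hA'
  · exact ballStar_mono (measure_mono Set.inter_subset_left) hB'
  · exact ballStar_mono (measure_mono Set.inter_subset_left) hC'

end BallStar

section LayerCake

lemma volume_ofReal_lt (a : ℝ≥0∞) : volume (Set.Ioi (0 : ℝ) ∩ {t | ENNReal.ofReal t < a}) = a := by
  by_cases h : a = ⊤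
  · subst h
    simp
  · lift a to NNReal using h
    have : Set.Ioi (0 : ℝ) ∩ {t | ENNReal.ofReal t < a} = Set.Ioo 0 (a : ℝ) := by
      ext t
      exact and_congr_right fun ht => ENNReal.ofReal_lt_coe_iff (le_of_lt ht)
    rw [this]
    simp

lemma lintegral_Ioi_indicator_ofReal_lt (a : ℝ≥0∞) :
    ∫⁻ t in Set.Ioi (0 : ℝ), {t : ℝ | ENNReal.ofReal t < a}.indicator 1 t = a := by
  have hm : MeasurableSet {t : ℝ | ENNReal.ofReal t < a} :=
    measurableSet_lt ENNReal.measurable_ofReal measurable_const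
  rw [lintegral_indicator_one hm, Measure.restrict_apply hm, Set.inter_comm, volume_ofReal_lt]

/-- Layer-cake formula for `[0,∞]`-valued functions, with a weight. -/
lemma lintegral_mul_eq_lintegral_setLIntegral {α : Type*} [MeasurableSpace α] (μ : Measure α)
    [SFinite μ] {u h : α → ℝ≥0∞} (hu : Measurable u) (hh : Measurable h) :
    ∫⁻ x, u x * h x ∂μ
      = ∫⁻ t in Set.Ioi (0 : ℝ), ∫⁻ x in {x | ENNReal.ofReal t < h x}, u x ∂μ := by
  have hm : ∀ t : ℝ, MeasurableSet {x | ENNReal.ofReal t < h x} := fun t =>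
    measurableSet_lt measurable_const hh
  have hS : MeasurableSet {p : α × ℝ | ENNReal.ofReal p.2 < h p.1} :=
    measurableSet_lt (ENNReal.measurable_ofReal.comp measurable_snd) (hh.comp measurable_fst)
  calc ∫⁻ x, u x * h x ∂μ
      = ∫⁻ x, (∫⁻ t in Set.Ioi (0 : ℝ),
          {p : α × ℝ | ENNReal.ofReal p.2 < h p.1}.indicator (fun p => u p.1) (x, t)) ∂μ := by
        refine lintegral_congr fun x => ?_
        conv_lhs => rw [← lintegral_Ioi_indicator_ofReal_lt (h x)]
        rw [← lintegral_const_mul _ (measurable_one.indicator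
          (measurableSet_lt ENNReal.measurable_ofReal measurable_const))]
        refine lintegral_congr fun t => ?_
        by_cases ht : ENNReal.ofReal t < h x <;> simp [Set.indicator, ht]
    _ = ∫⁻ t in Set.Ioi (0 : ℝ), ∫⁻ x,
          {p : α × ℝ | ENNReal.ofReal p.2 < h p.1}.indicator (fun p => u p.1) (x, t) ∂μ :=
        lintegral_lintegral_swap ((hu.comp measurable_fst).indicator hS).aemeasurable
    _ = _ := by
        refine lintegral_congr fun t => ?_
        rw [← lintegral_indicator (hm t)]
        rfl

end LayerCake

section Majorization

variable {d : ℕ}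

/-- `u` is dominated by `v` in the sense that the integral of `u` over any set of finite measure is
at most the integral of `v` over the centered ball of the same measure. -/
def RearrMajorized (u v : EuclideanSpace ℝ (Fin d) → ℝ≥0∞) : Prop :=
  ∀ A, MeasurableSet A → volume A ≠ ⊤ → ∫⁻ x in A, u x ≤ ∫⁻ x in ballStar A, v x

/-- `v x` is a nonincreasing function of `‖x‖`. -/
def RadiallyAntitone (v : EuclideanSpace ℝ (Fin d) → ℝ≥0∞) : Prop :=
  ∀ ⦃x y⦄, ‖x‖ ≤ ‖y‖ → v y ≤ v x

lemma RadiallyAntitone.measurable {v : EuclideanSpace ℝ (Fin d) → ℝ≥0∞}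
    (hv : RadiallyAntitone v) : Measurable v := by
  let g : ℝ → ℝ≥0∞ := fun r => ⨆ x, ⨆ (_ : r ≤ ‖x‖), v x
  have hg : Antitone g := fun r s hrs =>
    iSup_mono fun x => iSup_le fun hx => le_iSup_of_le (hrs.trans hx) le_rfl
  have : v = fun x => g ‖x‖ := by
    funext x
    exact le_antisymm (le_iSup₂_of_le x le_rfl le_rfl) (iSup₂_le fun y hy => hv hy)
  rw [this]
  exact hg.measurable.comp measurable_norm

lemma RadiallyAntitone.mul {u v : EuclideanSpace ℝ (Fin d) → ℝ≥0∞}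
    (hu : RadiallyAntitone u) (hv : RadiallyAntitone v) :
    RadiallyAntitone fun x => u x * v x :=
  fun _ _ h => mul_le_mul' (hu h) (hv h)

lemma radiallyAntitone_symmRearrange (f : EuclideanSpace ℝ (Fin d) → ℝ) :
    RadiallyAntitone (symmRearrange f) := fun x y h => by
  refine lintegral_mono fun t => ?_
  by_cases hy : y ∈ ballStar {y | t < f y}
  · have hx : x ∈ ballStar {y | t < f y} := by
      rw [ballStar, mem_ball_zero_iff] at hy ⊢
      exact h.trans_lt hy
    simp [hx, hy]
  · simp [hy]

lemma measurable_symmRadius_superlevel (f : EuclideanSpace ℝ (Fin d) → ℝ) :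
    Measurable fun t : ℝ => symmRadius {y | t < f y} := by
  have h : Antitone fun t : ℝ => volume {y | t < f y} := fun s t hst =>
    measure_mono fun y (hy : t < f y) => hst.trans_lt hy
  exact ((h.measurable.div_const _).ennreal_toReal).pow_const _

lemma measurableSet_ballStar_superlevel (f : EuclideanSpace ℝ (Fin d) → ℝ) :
    MeasurableSet {p : EuclideanSpace ℝ (Fin d) × ℝ | p.1 ∈ ballStar {y | p.2 < f y}} := by
  simp only [ballStar, mem_ball_zero_iff]
  exact measurableSet_lt measurable_fst.norm
    ((measurable_symmRadius_superlevel f).comp measurable_snd)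

lemma lintegral_mul_symmRearrange (f : EuclideanSpace ℝ (Fin d) → ℝ)
    {w : EuclideanSpace ℝ (Fin d) → ℝ≥0∞} (hw : Measurable w) :
    ∫⁻ x, w x * symmRearrange f x
      = ∫⁻ t in Set.Ioi (0 : ℝ), ∫⁻ x in ballStar {y | t < f y}, w x := by
  have hS := measurableSet_ballStar_superlevel f
  calc ∫⁻ x, w x * symmRearrange f x
      = ∫⁻ x, ∫⁻ t in Set.Ioi (0 : ℝ),
          {p : EuclideanSpace ℝ (Fin d) × ℝ | p.1 ∈ ballStar {y | p.2 < f y}}.indicator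
            (fun p => w p.1) (x, t) := by
        refine lintegral_congr fun x => ?_
        have hSx : MeasurableSet {t : ℝ | x ∈ ballStar {y | t < f y}} :=
          measurable_prodMk_left hS
        have hm : Measurable fun t : ℝ =>
            (ballStar {y | t < f y}).indicator (fun _ => (1 : ℝ≥0∞)) x :=
          measurable_const.indicator hSx
        rw [symmRearrange, ← lintegral_const_mul _ hm]
        refine lintegral_congr fun t => ?_
        by_cases ht : x ∈ ballStar {y | t < f y} <;> simp [Set.indicator, ht]
    _ = ∫⁻ t in Set.Ioi (0 : ℝ), ∫⁻ x,
          {p : EuclideanSpace ℝ (Fin d) × ℝ | p.1 ∈ ballStar {y | p.2 < f y}}.indicator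
            (fun p => w p.1) (x, t) :=
        lintegral_lintegral_swap ((hw.comp measurable_fst).indicator hS).aemeasurable
    _ = _ := by
        refine lintegral_congr fun t => ?_
        rw [← lintegral_indicator (measurableSet_ballStar _)]
        rfl

lemma setLIntegral_symmRearrange (f : EuclideanSpace ℝ (Fin d) → ℝ)
    {C : Set (EuclideanSpace ℝ (Fin d))} (hC : MeasurableSet C) :
    ∫⁻ x in C, symmRearrange f x
      = ∫⁻ t in Set.Ioi (0 : ℝ), volume (C ∩ ballStar {y | t < f y}) := by
  rw [← lintegral_indicator hC]
  have h := lintegral_mul_symmRearrange f (w := C.indicator 1) (measurable_one.indicator hC)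
  have h' : ∀ x, C.indicator 1 x * symmRearrange f x = C.indicator (symmRearrange f) x :=
      fun x => by
    by_cases hx : x ∈ C <;> simp [hx]
  simp only [h', lintegral_indicator_one hC, Measure.restrict_apply hC] at h
  exact h

lemma lintegral_mul_ofReal_eq (μ : Measure (EuclideanSpace ℝ (Fin d))) [SFinite μ]
    {u : EuclideanSpace ℝ (Fin d) → ℝ≥0∞} (hu : Measurable u)
    {f : EuclideanSpace ℝ (Fin d) → ℝ} (hf : Measurable f) :
    ∫⁻ x, u x * ENNReal.ofReal (f x) ∂μ
      = ∫⁻ t in Set.Ioi (0 : ℝ), ∫⁻ x in {x | t < f x}, u x ∂μ := by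
  rw [lintegral_mul_eq_lintegral_setLIntegral μ hu hf.ennreal_ofReal]
  refine setLIntegral_congr_fun measurableSet_Ioi fun t (ht : 0 < t) => ?_
  simp only [ENNReal.ofReal_lt_ofReal_iff_of_nonneg ht.le]

lemma RearrMajorized.mul_ofReal {u v : EuclideanSpace ℝ (Fin d) → ℝ≥0∞}
    (huv : RearrMajorized u v) (hu : Measurable u) (hv : Measurable v)
    {f : EuclideanSpace ℝ (Fin d) → ℝ} (hf : Measurable f) (hfv : VanishesAtInfinity f) :
    RearrMajorized (fun x => u x * ENNReal.ofReal (f x)) fun x => v x * symmRearrange f x := by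
  intro A hA hA'
  have hB : MeasurableSet (ballStar A) := measurableSet_ballStar A
  rw [lintegral_mul_ofReal_eq _ hu hf, ← lintegral_indicator hB]
  have h := lintegral_mul_symmRearrange f (w := (ballStar A).indicator v) (hv.indicator hB)
  have h' : ∀ x, (ballStar A).indicator (fun x => v x * symmRearrange f x) x
      = (ballStar A).indicator v x * symmRearrange f x := fun x =>
    Set.indicator_mul_left _ _ _
  simp only [h', h]
  refine setLIntegral_mono' measurableSet_Ioi fun t (ht : 0 < t) => ?_
  have hft : MeasurableSet {x | t < f x} := measurableSet_lt measurable_const hf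
  rw [Measure.restrict_restrict hft, setLIntegral_indicator hB]
  refine (huv _ (hft.inter hA) (ne_top_of_le_ne_top hA'
    (measure_mono Set.inter_subset_right))).trans (lintegral_mono_set (Set.subset_inter ?_ ?_))
  · exact ballStar_mono (measure_mono Set.inter_subset_right) hA'
  · exact ballStar_mono (measure_mono Set.inter_subset_left) (hfv t ht).ne

lemma RearrMajorized.lintegral_mul_ofReal_le {u v : EuclideanSpace ℝ (Fin d) → ℝ≥0∞}
    (huv : RearrMajorized u v) (hu : Measurable u) (hv : Measurable v)
    {f : EuclideanSpace ℝ (Fin d) → ℝ} (hf : Measurable f) (hfv : VanishesAtInfinity f) :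
    ∫⁻ x, u x * ENNReal.ofReal (f x) ≤ ∫⁻ x, v x * symmRearrange f x := by
  rw [lintegral_mul_ofReal_eq _ hu hf, lintegral_mul_symmRearrange f hv]
  exact setLIntegral_mono' measurableSet_Ioi fun t ht =>
    huv _ (measurableSet_lt measurable_const hf) (hfv t ht).ne

lemma lintegral_symmRearrange (hd : 1 ≤ d) {f : EuclideanSpace ℝ (Fin d) → ℝ} (hf : Measurable f)
    (hfv : VanishesAtInfinity f) :
    ∫⁻ x, symmRearrange f x = ∫⁻ x, ENNReal.ofReal (f x) := by
  have h1 := lintegral_mul_ofReal_eq (u := fun _ => 1) volume measurable_const hf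
  have h2 := lintegral_mul_symmRearrange f (w := fun _ => 1) measurable_const
  simp only [one_mul, lintegral_one, Measure.restrict_apply_univ] at h1 h2
  rw [h1, h2]
  exact setLIntegral_congr_fun measurableSet_Ioi fun t ht => volume_ballStar hd (hfv t ht).ne

lemma RearrMajorized.setLIntegral_symmRearrange_le (hd : 1 ≤ d)
    {f : EuclideanSpace ℝ (Fin d) → ℝ} {k : EuclideanSpace ℝ (Fin d) → ℝ≥0∞}
    (hfk : RearrMajorized (fun x => ENNReal.ofReal (f x)) k) (hf : Measurable f)
    (hfv : VanishesAtInfinity f) (hk : RadiallyAntitone k) (hk' : ∀ x, k x ≠ ⊤)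
    (hint : ∫⁻ x, ENNReal.ofReal (f x) ≤ ∫⁻ x, k x)
    {C : Set (EuclideanSpace ℝ (Fin d))} (hC : MeasurableSet C)
    (hCl : ∀ x ∈ C, ∀ y, ‖y‖ ≤ ‖x‖ → y ∈ C) :
    ∫⁻ x in C, symmRearrange f x ≤ ∫⁻ x in C, k x := by
  rcases C.eq_empty_or_nonempty with rfl | ⟨x₀, hx₀⟩
  · simp
  set t₀ : ℝ≥0∞ := ⨅ x ∈ C, k x with ht₀
  have hin : ∀ x ∈ C, t₀ ≤ k x := fun x hx => iInf₂_le x hx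
  have hout : ∀ x, x ∉ C → k x ≤ t₀ := fun x hx => le_iInf₂ fun y hy =>
    hk (le_of_not_ge fun h => hx (hCl y hy x h))
  have htop : t₀ ≠ ⊤ := ne_top_of_le_ne_top (hk' x₀) (hin x₀ hx₀)
  rcases eq_or_ne t₀ 0 with h0 | h0
  · calc ∫⁻ x in C, symmRearrange f x ≤ ∫⁻ x, symmRearrange f x := setLIntegral_le_lintegral _ _
      _ ≤ ∫⁻ x, k x := (lintegral_symmRearrange hd hf hfv).trans_le hint
      _ = ∫⁻ x in C, k x := by
        rw [← lintegral_indicator hC]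
        refine lintegral_congr fun x => ?_
        by_cases hx : x ∈ C
        · simp [hx]
        · simpa [hx, h0] using hout x hx
  have hr0 : 0 < t₀.toReal := ENNReal.toReal_pos h0 htop
  set D : Set (EuclideanSpace ℝ (Fin d)) := {x | t₀.toReal < f x} with hD
  have hDm : MeasurableSet D := measurableSet_lt measurable_const hf
  have hDtop : volume D ≠ ⊤ := (hfv _ hr0).ne
  have hDs : MeasurableSet (ballStar D) := measurableSet_ballStar D
  have hconst : ∀ c : ℝ≥0∞, ∫⁻ t in Set.Ioi (0 : ℝ),
      c * {t : ℝ | ENNReal.ofReal t < t₀}.indicator 1 t = c * t₀ := fun c => by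
    rw [lintegral_const_mul _ (measurable_one.indicator
      (measurableSet_lt ENNReal.measurable_ofReal measurable_const)),
      lintegral_Ioi_indicator_ofReal_lt]
  have hmeas : ∀ c : ℝ≥0∞, Measurable fun t : ℝ =>
      c * {t : ℝ | ENNReal.ofReal t < t₀}.indicator 1 t := fun c =>
    (measurable_one.indicator
      (measurableSet_lt ENNReal.measurable_ofReal measurable_const)).const_mul c
  have step1 : (∫⁻ x in C, symmRearrange f x) + volume D * t₀
      ≤ volume C * t₀ + ∫⁻ x in D, ENNReal.ofReal (f x) := by
    have h1 := lintegral_mul_ofReal_eq (u := fun _ => 1) (volume.restrict D) measurable_const hf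
    simp only [one_mul, lintegral_one, Measure.restrict_apply_univ] at h1
    rw [setLIntegral_symmRearrange f hC, h1, ← hconst, ← hconst, ← lintegral_add_right _ (hmeas _),
      ← lintegral_add_left (hmeas _)]
    refine setLIntegral_mono' measurableSet_Ioi fun t (ht : 0 < t) => ?_
    have hft : MeasurableSet {x | t < f x} := measurableSet_lt measurable_const hf
    rw [Measure.restrict_apply hft]
    rcases lt_or_ge (ENNReal.ofReal t) t₀ with h | h
    · have hDt : D ⊆ {x | t < f x} := fun x (hx : _ < f x) =>
        ((ENNReal.ofReal_lt_iff_lt_toReal ht.le htop).1 h).trans hx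
      rw [Set.inter_eq_self_of_subset_right hDt]
      simp only [Set.indicator, Set.mem_ofPred_eq, h, if_true, Pi.one_apply, mul_one]
      gcongr
      exact Set.inter_subset_left
    · have hDt : {x | t < f x} ⊆ D := fun x (hx : t < f x) =>
        (ENNReal.toReal_le_of_le_ofReal ht.le h).trans_lt hx
      rw [Set.inter_eq_self_of_subset_left hDt]
      simp only [Set.indicator, Set.mem_ofPred_eq, not_lt.2 h, if_false, mul_zero, add_zero,
        zero_add]
      exact (measure_mono Set.inter_subset_right).trans (volume_ballStar hd (hfv t ht).ne).le
  have step2 : volume C * t₀ + ∫⁻ x in ballStar D, k x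
      ≤ (∫⁻ x in C, k x) + volume D * t₀ := by
    rw [← volume_ballStar hd hDtop, mul_comm, mul_comm _ t₀,
      ← lintegral_indicator_const hC, ← lintegral_indicator_const hDs, ← lintegral_indicator hC,
      ← lintegral_indicator hDs, ← lintegral_add_left (measurable_const.indicator hC),
      ← lintegral_add_right _ (measurable_const.indicator hDs)]
    refine lintegral_mono fun x => ?_
    by_cases h1 : x ∈ C <;> by_cases h2 : x ∈ ballStar D <;>
      simp only [h1, h2, Set.indicator_of_mem, Set.indicator_of_notMem, not_false_eq_true,
        add_zero, zero_add, le_refl]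
    · exact (add_comm _ _).le
    · exact hin x h1
    · exact hout x h1
  have hfin : volume D * t₀ ≠ ⊤ := ENNReal.mul_ne_top hDtop htop
  refine (ENNReal.add_le_add_iff_right hfin).1 (step1.trans (le_trans ?_ step2))
  exact add_le_add le_rfl (hfk D hDm hDtop)

theorem RearrMajorized.lintegral_mul_le (hd : 1 ≤ d)
    {u v : EuclideanSpace ℝ (Fin d) → ℝ≥0∞} (huv : RearrMajorized u v) (hu : Measurable u)
    (hv : RadiallyAntitone v) {f : EuclideanSpace ℝ (Fin d) → ℝ}
    {k : EuclideanSpace ℝ (Fin d) → ℝ≥0∞}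
    (hfk : RearrMajorized (fun x => ENNReal.ofReal (f x)) k) (hf : Measurable f)
    (hfv : VanishesAtInfinity f) (hk : RadiallyAntitone k) (hk' : ∀ x, k x ≠ ⊤)
    (hint : ∫⁻ x, ENNReal.ofReal (f x) ≤ ∫⁻ x, k x) :
    ∫⁻ x, u x * ENNReal.ofReal (f x) ≤ ∫⁻ x, v x * k x := by
  refine (huv.lintegral_mul_ofReal_le hu hv.measurable hf hfv).trans ?_
  simp only [mul_comm (v _)]
  rw [lintegral_mul_eq_lintegral_setLIntegral volume
      (radiallyAntitone_symmRearrange f).measurable hv.measurable,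
    lintegral_mul_eq_lintegral_setLIntegral volume hk.measurable hv.measurable]
  refine lintegral_mono fun t => hfk.setLIntegral_symmRearrange_le hd hf hfv hk hk' hint
    (measurableSet_lt measurable_const hv.measurable) fun x hx y hyx => ?_
  exact lt_of_lt_of_le hx (hv hyx)

end Majorization

section Convolution

variable {d : ℕ}

lemma ENNReal.mul_add_mul_le_mul_add_mul_of_le {a b c e : ℝ≥0∞} (hab : a ≤ b) (hce : c ≤ e) :
    a * e + b * c ≤ a * c + b * e := by
  obtain ⟨s, rfl⟩ := exists_add_of_le hab
  obtain ⟨t, rfl⟩ := exists_add_of_le hce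
  calc a * (c + t) + (a + s) * c ≤ a * (c + t) + (a + s) * c + s * t := le_self_add
    _ = a * c + (a + s) * (c + t) := by ring

lemma RadiallyAntitone.lintegral_mul_comp_add {w v : EuclideanSpace ℝ (Fin d) → ℝ≥0∞}
    (hw : RadiallyAntitone w) (hv : RadiallyAntitone v) :
    RadiallyAntitone fun y => ∫⁻ x, w x * v (y + x) := by
  intro y y' hyy'
  rcases eq_or_ne y y' with rfl | hne
  · exact le_rfl
  set n : EuclideanSpace ℝ (Fin d) := y' - y with hn
  set m : EuclideanSpace ℝ (Fin d) := (1 / 2 : ℝ) • (y + y') with hm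
  have hn0 : n ≠ 0 := sub_ne_zero.2 hne.symm
  have hn2 : 0 < ‖n‖ ^ 2 := by positivity
  have hmn : 0 ≤ ⟪m, n⟫ := by
    have h : ⟪m, n⟫ = (1 / 2) * (‖y'‖ ^ 2 - ‖y‖ ^ 2) := by
      rw [hm, hn, real_inner_smul_left, inner_add_left, inner_sub_right, inner_sub_right,
        real_inner_self_eq_norm_sq, real_inner_self_eq_norm_sq, real_inner_comm y' y]
      ring
    rw [h]
    have := pow_le_pow_left₀ (norm_nonneg y) hyy' 2
    linarith
  let R : EuclideanSpace ℝ (Fin d) ≃ₗᵢ[ℝ] EuclideanSpace ℝ (Fin d) :=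
    (Submodule.span ℝ {n})ᗮ.reflection
  have hR : ∀ q, R q = q - (2 * (⟪n, q⟫ / ‖n‖ ^ 2)) • n := fun q => by
    simp only [R]
    rw [Submodule.reflection_orthogonal_apply, Submodule.reflection_singleton_apply]
    simp [two_mul, add_smul, two_smul]
  have hRn : R n = -n := Submodule.reflection_orthogonalComplement_singleton_eq_neg n
  have hRR : ∀ q, R (R q) = q := fun q => Submodule.reflection_reflection _ q
  have hRmp : MeasurePreserving R volume volume := R.measurePreserving
  let G : EuclideanSpace ℝ (Fin d) → ℝ≥0∞ := fun q => w (q - (1 / 2 : ℝ) • n)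
  let g : EuclideanSpace ℝ (Fin d) → ℝ≥0∞ := fun q => v (m + q)
  have hG : Measurable G := hw.measurable.comp (measurable_id.sub_const _)
  have hg : Measurable g := hv.measurable.comp (measurable_id.const_add _)
  have hnorm : ∀ {p q : EuclideanSpace ℝ (Fin d)}, ‖p‖ ^ 2 ≤ ‖q‖ ^ 2 → ‖p‖ ≤ ‖q‖ := fun h =>
    (pow_le_pow_iff_left₀ (norm_nonneg _) (norm_nonneg _) two_ne_zero).1 h
  have hnR : ∀ q, ⟪n, R q⟫ = -⟪n, q⟫ := fun q => by
    rw [hR, inner_sub_right, real_inner_smul_right, real_inner_self_eq_norm_sq]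
    field_simp
    ring
  have hgle : ∀ q, 0 ≤ ⟪n, q⟫ → g q ≤ g (R q) := fun q hq => by
    refine hv (hnorm ?_)
    rw [norm_add_sq_real, norm_add_sq_real, R.norm_map]
    have h : ⟪m, R q⟫ ≤ ⟪m, q⟫ := by
      rw [hR, inner_sub_right, real_inner_smul_right, sub_le_self_iff]
      positivity
    linarith
  have hGle : ∀ q, 0 ≤ ⟪n, q⟫ → G (R q) ≤ G q := fun q hq => by
    refine hw (hnorm ?_)
    rw [norm_sub_sq_real, norm_sub_sq_real, R.norm_map, real_inner_smul_right,
      real_inner_smul_right, real_inner_comm n, real_inner_comm n, hnR]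
    linarith
  have hpt : ∀ q, G q * g q + G (R q) * g (R q) ≤ G (R q) * g q + G q * g (R q) := fun q => by
    rcases le_total 0 ⟪n, q⟫ with h | h
    · rw [add_comm]
      exact ENNReal.mul_add_mul_le_mul_add_mul_of_le (hGle q h) (hgle q h)
    · have h' : 0 ≤ ⟪n, R q⟫ := by rw [hnR]; linarith
      have h1 := hGle _ h'
      have h2 := hgle _ h'
      rw [hRR] at h1 h2
      rw [add_comm (G (R q) * g q)]
      exact ENNReal.mul_add_mul_le_mul_add_mul_of_le h1 h2
  have e1 : ∫⁻ x, w x * v (y' + x) = ∫⁻ q, G q * g q := by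
    rw [← lintegral_sub_right_eq_self (fun x => w x * v (y' + x)) ((1 / 2 : ℝ) • n)]
    refine lintegral_congr fun q => ?_
    have : y' + (q - (1 / 2 : ℝ) • n) = m + q := by
      rw [hm, hn]; module
    rw [this]
  have e2 : ∫⁻ x, w x * v (y + x) = ∫⁻ q, G (R q) * g q := by
    rw [← lintegral_add_right_eq_self (fun x => w x * v (y + x)) ((1 / 2 : ℝ) • n)]
    refine lintegral_congr fun q => ?_
    have h1 : y + (q + (1 / 2 : ℝ) • n) = m + q := by
      rw [hm, hn]; module
    have h2 : R q - (1 / 2 : ℝ) • n = R (q + (1 / 2 : ℝ) • n) := by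
      rw [map_add, map_smul, hRn]; module
    have h3 : ‖R q - (1 / 2 : ℝ) • n‖ = ‖q + (1 / 2 : ℝ) • n‖ := by rw [h2, R.norm_map]
    rw [h1, le_antisymm (hw h3.le) (hw h3.ge)]
  have hGg : Measurable fun q => G q * g q := hG.mul hg
  have hGRg : Measurable fun q => G (R q) * g q := (hG.comp hRmp.measurable).mul hg
  have s1 : ∫⁻ q, G (R q) * g (R q) = ∫⁻ q, G q * g q :=
    hRmp.lintegral_comp hGg
  have s2 : ∫⁻ q, G q * g (R q) = ∫⁻ q, G (R q) * g q := by
    have h := hRmp.lintegral_comp hGRg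
    simpa only [hRR] using h
  have htot := lintegral_mono (μ := volume) hpt
  rw [lintegral_add_left hGg, lintegral_add_left hGRg, s1, s2, ← two_mul, ← two_mul] at htot
  refine e1.trans_le (le_trans ?_ e2.ge)
  exact (ENNReal.mul_le_mul_iff_right two_ne_zero ENNReal.ofNat_ne_top).1 htot

/-- The measure of the set of `y ∈ A` with `z - y ∈ B`, that is `1_A ∗ 1_B`. -/
noncomputable def overlap (A B : Set (EuclideanSpace ℝ (Fin d)))
    (z : EuclideanSpace ℝ (Fin d)) : ℝ≥0∞ :=
  volume (A ∩ {y | z - y ∈ B})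

lemma measurable_overlap {A B : Set (EuclideanSpace ℝ (Fin d))} (hA : MeasurableSet A)
    (hB : MeasurableSet B) : Measurable (overlap A B) :=
  measurable_measure_prodMk_left (s := {p : EuclideanSpace ℝ (Fin d) × EuclideanSpace ℝ (Fin d) |
    p.2 ∈ A ∧ p.1 - p.2 ∈ B})
    ((measurable_snd hA).inter ((measurable_fst.sub measurable_snd) hB))

lemma overlap_ne_top {A B : Set (EuclideanSpace ℝ (Fin d))} (hA : volume A ≠ ⊤)
    (z : EuclideanSpace ℝ (Fin d)) : overlap A B z ≠ ⊤ :=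
  ne_top_of_le_ne_top hA (measure_mono Set.inter_subset_left)

lemma setLIntegral_setLIntegral_comp_add {A B : Set (EuclideanSpace ℝ (Fin d))}
    (hB : MeasurableSet B) {w : EuclideanSpace ℝ (Fin d) → ℝ≥0∞} (hw : Measurable w) :
    ∫⁻ x in B, ∫⁻ y in A, w (y + x) = ∫⁻ z, w z * overlap A B z := by
  calc ∫⁻ x in B, ∫⁻ y in A, w (y + x)
      = ∫⁻ y in A, ∫⁻ x in B, w (y + x) :=
        lintegral_lintegral_swap (hw.comp (measurable_snd.add measurable_fst)).aemeasurable
    _ = ∫⁻ y in A, ∫⁻ z, w z * B.indicator 1 (z - y) := by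
        refine lintegral_congr fun y => ?_
        rw [← lintegral_indicator hB,
          ← lintegral_sub_right_eq_self (fun x => B.indicator (fun x => w (y + x)) x) y]
        refine lintegral_congr fun z => ?_
        by_cases h : z - y ∈ B <;> simp [h]
    _ = ∫⁻ z, ∫⁻ y in A, w z * B.indicator 1 (z - y) :=
        lintegral_lintegral_swap ((hw.comp measurable_snd).mul
          ((measurable_one.indicator hB).comp (measurable_snd.sub measurable_fst))).aemeasurable
    _ = ∫⁻ z, w z * overlap A B z := by
        refine lintegral_congr fun z => ?_
        have hm : Measurable fun y : EuclideanSpace ℝ (Fin d) => z - y :=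
          measurable_const.sub measurable_id
        have hm' : Measurable fun y => B.indicator (1 : EuclideanSpace ℝ (Fin d) → ℝ≥0∞) (z - y) :=
          (measurable_one.indicator hB).comp hm
        rw [lintegral_const_mul _ hm']
        congr 1
        have h := lintegral_indicator_one (μ := volume.restrict A) (hm hB)
        rw [Measure.restrict_apply (hm hB), Set.inter_comm] at h
        exact h

lemma lintegral_overlap (A : Set (EuclideanSpace ℝ (Fin d))) {B : Set (EuclideanSpace ℝ (Fin d))}
    (hB : MeasurableSet B) : ∫⁻ z, overlap A B z = volume A * volume B := by
  have h := setLIntegral_setLIntegral_comp_add (A := A) hB (w := fun _ => 1) measurable_const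
  simpa using h.symm

lemma setLIntegral_overlap {A B C : Set (EuclideanSpace ℝ (Fin d))} (hA : MeasurableSet A)
    (hB : MeasurableSet B) (hC : MeasurableSet C) :
    ∫⁻ z in C, overlap A B z = volume (sumTriple A B C) := by
  have h := setLIntegral_setLIntegral_comp_add (A := A) hB (w := C.indicator 1)
    (measurable_one.indicator hC)
  have h1 : ∫⁻ z, C.indicator 1 z * overlap A B z = ∫⁻ z in C, overlap A B z := by
    rw [← lintegral_indicator hC]
    refine lintegral_congr fun z => ?_
    by_cases hz : z ∈ C <;> simp [hz]
  have hT : MeasurableSet (sumTriple A B C) := measurableSet_sumTriple hA hB hC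
  rw [← h1, ← h, Measure.volume_eq_prod, ← lintegral_indicator_one hT,
    lintegral_prod_symm' _ (measurable_one.indicator hT), ← lintegral_indicator hB]
  refine lintegral_congr fun x => ?_
  by_cases hx : x ∈ B
  · rw [Set.indicator_of_mem hx, ← lintegral_indicator hA]
    refine lintegral_congr fun y => ?_
    by_cases hy : y ∈ A <;> by_cases hyx : y + x ∈ C <;>
      simp [Set.indicator, sumTriple, hx, hy, hyx]
  · simp [Set.indicator, sumTriple, hx]

lemma rearrMajorized_overlap (hd : 1 ≤ d) {A B : Set (EuclideanSpace ℝ (Fin d))}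
    (hA : MeasurableSet A) (hB : MeasurableSet B) (hA' : volume A ≠ ⊤) (hB' : volume B ≠ ⊤) :
    RearrMajorized (overlap A B) (overlap (ballStar A) (ballStar B)) := fun C hC hC' => by
  rw [setLIntegral_overlap hA hB hC, setLIntegral_overlap (measurableSet_ballStar _)
    (measurableSet_ballStar _) (measurableSet_ballStar _)]
  exact measure_sumTriple_le_ballStar hd hA hB hC hA' hB' hC'

lemma radiallyAntitone_indicator_ball (r : ℝ) :
    RadiallyAntitone ((Metric.ball (0 : EuclideanSpace ℝ (Fin d)) r).indicator 1) := by
  intro x y h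
  by_cases hy : y ∈ Metric.ball (0 : EuclideanSpace ℝ (Fin d)) r
  · have hx : x ∈ Metric.ball (0 : EuclideanSpace ℝ (Fin d)) r :=
      mem_ball_zero_iff.2 (h.trans_lt (mem_ball_zero_iff.1 hy))
    simp [Set.indicator_of_mem hx, Set.indicator_of_mem hy]
  · simp [Set.indicator_of_notMem hy]

lemma radiallyAntitone_overlap_ball (a b : ℝ) :
    RadiallyAntitone (overlap (Metric.ball (0 : EuclideanSpace ℝ (Fin d)) a)
      (Metric.ball 0 b)) := by
  have h := (radiallyAntitone_indicator_ball (d := d) a).lintegral_mul_comp_add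
    (radiallyAntitone_indicator_ball b)
  have h' : ∀ z, overlap (Metric.ball (0 : EuclideanSpace ℝ (Fin d)) a) (Metric.ball 0 b) z
      = ∫⁻ x, (Metric.ball 0 a).indicator 1 x * (Metric.ball 0 b).indicator 1 (z + x) := fun z => by
    have hm : Measurable fun y : EuclideanSpace ℝ (Fin d) => z - y :=
      measurable_const.sub measurable_id
    have hS : MeasurableSet (Metric.ball 0 a ∩ {y | z - y ∈ Metric.ball 0 b}) :=
      Metric.isOpen_ball.measurableSet.inter (hm Metric.isOpen_ball.measurableSet)
    rw [← lintegral_neg_eq_self, overlap, ← lintegral_indicator_one hS]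
    refine lintegral_congr fun x => ?_
    by_cases h1 : ‖x‖ < a <;> by_cases h2 : ‖z - x‖ < b <;>
      simp [Set.indicator, h1, h2, ← sub_eq_add_neg]
  intro x y hxy
  rw [h', h']
  exact h hxy

lemma RearrMajorized.lintegral_mul_overlap_le (hd : 1 ≤ d)
    {u v : EuclideanSpace ℝ (Fin d) → ℝ≥0∞} (huv : RearrMajorized u v) (hu : Measurable u)
    (hv : RadiallyAntitone v) {A B : Set (EuclideanSpace ℝ (Fin d))}
    (hA : MeasurableSet A) (hB : MeasurableSet B) (hA' : volume A ≠ ⊤) (hB' : volume B ≠ ⊤) :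
    ∫⁻ z, u z * overlap A B z ≤ ∫⁻ z, v z * overlap (ballStar A) (ballStar B) z := by
  have hof : ∀ z, ENNReal.ofReal (overlap A B z).toReal = overlap A B z := fun z =>
    ENNReal.ofReal_toReal (overlap_ne_top hA' z)
  have hint := lintegral_overlap A hB
  have hA'' : volume (ballStar A) ≠ ⊤ := by rwa [volume_ballStar hd hA']
  have key := huv.lintegral_mul_le hd hu hv (f := fun z => (overlap A B z).toReal)
    (k := overlap (ballStar A) (ballStar B)) (by
      simp only [hof]
      exact rearrMajorized_overlap hd hA hB hA' hB') (measurable_overlap hA hB).ennreal_toReal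
    (fun t ht => by
      have hsub : {z | t < (overlap A B z).toReal} ⊆ {z | ENNReal.ofReal t ≤ overlap A B z} :=
        fun z (hz : t < _) => (ENNReal.ofReal_le_ofReal hz.le).trans (hof z).le
      have ht' : ENNReal.ofReal t ≠ 0 := (ENNReal.ofReal_pos.2 ht).ne'
      refine (measure_mono hsub).trans_lt ((meas_ge_le_lintegral_div
        (measurable_overlap hA hB).aemeasurable ht' ENNReal.ofReal_ne_top).trans_lt ?_)
      rw [hint]
      exact ENNReal.div_lt_top (ENNReal.mul_ne_top hA' hB') ht')
    (radiallyAntitone_overlap_ball _ _) (overlap_ne_top hA'') (by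
      simp only [hof]
      rw [hint, lintegral_overlap (ballStar A) (measurableSet_ballStar B),
        volume_ballStar hd hA', volume_ballStar hd hB'])
  simpa only [hof] using key

theorem RearrMajorized.lintegral_comp_add (hd : 1 ≤ d)
    {u v : EuclideanSpace ℝ (Fin d) → ℝ≥0∞} (huv : RearrMajorized u v) (hu : Measurable u)
    (hv : RadiallyAntitone v) {φ : EuclideanSpace ℝ (Fin d) → ℝ} (hφ : Measurable φ)
    (hφv : VanishesAtInfinity φ) :
    RearrMajorized (fun y => ∫⁻ x, ENNReal.ofReal (φ x) * u (y + x))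
      fun y => ∫⁻ x, symmRearrange φ x * v (y + x) := by
  intro A hA hA'
  have hswap : ∀ {w g : EuclideanSpace ℝ (Fin d) → ℝ≥0∞} (S : Set (EuclideanSpace ℝ (Fin d))),
      Measurable w → Measurable g →
      ∫⁻ y in S, ∫⁻ x, g x * w (y + x) = ∫⁻ x, (∫⁻ y in S, w (y + x)) * g x := by
    intro w g S hw hg
    rw [lintegral_lintegral_swap ((hg.comp measurable_snd).mul
      (hw.comp (measurable_fst.add measurable_snd))).aemeasurable]
    refine lintegral_congr fun x => ?_
    have hwx : Measurable fun y => w (y + x) := hw.comp (measurable_add_const x)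
    rw [lintegral_const_mul _ hwx, mul_comm]
  have hmeas : ∀ {w : EuclideanSpace ℝ (Fin d) → ℝ≥0∞} (S : Set (EuclideanSpace ℝ (Fin d))),
      Measurable w → Measurable fun x => ∫⁻ y in S, w (y + x) := fun S hw =>
    Measurable.lintegral_prod_left' (f := fun p => _)
      (hw.comp (measurable_fst.add measurable_snd))
  rw [hswap A hu hφ.ennreal_ofReal,
    hswap (ballStar A) hv.measurable (radiallyAntitone_symmRearrange φ).measurable,
    lintegral_mul_ofReal_eq _ (hmeas A hu) hφ,
    lintegral_mul_symmRearrange _ (hmeas _ hv.measurable)]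
  refine setLIntegral_mono' measurableSet_Ioi fun t ht => ?_
  have hB : MeasurableSet {x | t < φ x} := measurableSet_lt measurable_const hφ
  rw [setLIntegral_setLIntegral_comp_add hB hu, setLIntegral_setLIntegral_comp_add
    (measurableSet_ballStar _) hv.measurable]
  exact huv.lintegral_mul_overlap_le hd hu hv hA hB hA' (hφv t ht).ne

end Convolution

section RandomWalk

variable {d : ℕ}

lemma rearrMajorized_one (hd : 1 ≤ d) :
    RearrMajorized (fun _ : EuclideanSpace ℝ (Fin d) => 1) fun _ => 1 := fun A _ hA => by
  simp [volume_ballStar hd hA]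

lemma radiallyAntitone_finset_prod {ι : Type*} (S : Finset ι)
    {v : ι → EuclideanSpace ℝ (Fin d) → ℝ≥0∞} (hv : ∀ i, RadiallyAntitone (v i)) :
    RadiallyAntitone fun x => ∏ i ∈ S, v i x :=
  fun _ _ h => Finset.prod_le_prod' fun i _ => hv i h

lemma RearrMajorized.mul_prod_ofReal {ι : Type*}
    {f : ι → EuclideanSpace ℝ (Fin d) → ℝ} (hf : ∀ i, Measurable (f i))
    (hfv : ∀ i, VanishesAtInfinity (f i)) (S : Finset ι)
    {u v : EuclideanSpace ℝ (Fin d) → ℝ≥0∞} (huv : RearrMajorized u v) (hu : Measurable u)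
    (hv : RadiallyAntitone v) :
    RearrMajorized (fun x => u x * ∏ i ∈ S, ENNReal.ofReal (f i x))
      fun x => v x * ∏ i ∈ S, symmRearrange (f i) x := by
  classical
  induction S using Finset.induction_on with
  | empty => simpa using huv
  | insert i S hi ih =>
    have h := ih.mul_ofReal
      (hu.mul (Finset.measurable_prod S fun j _ => (hf j).ennreal_ofReal))
      (hv.mul (radiallyAntitone_finset_prod S fun j =>
        radiallyAntitone_symmRearrange (f j))).measurable (hf i) (hfv i)
    convert h using 2 with x x
    · rw [Finset.prod_insert hi]; ring
    · rw [Finset.prod_insert hi]; ring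

/-- The expectation-type functional of a walk with `K` steps of density `ψ` started at `x₀`, where
`g i` is evaluated after `k i` steps for `i ∈ S`. -/
noncomputable def walkIntegral {ι : Type*} (g : ι → EuclideanSpace ℝ (Fin d) → ℝ≥0∞)
    (ψ : EuclideanSpace ℝ (Fin d) → ℝ≥0∞) (K : ℕ) (S : Finset ι) (k : ι → ℕ)
    (x₀ : EuclideanSpace ℝ (Fin d)) : ℝ≥0∞ :=
  ∫⁻ x : Fin K → EuclideanSpace ℝ (Fin d),
    (∏ i ∈ S, g i (x₀ + partialSum x (k i))) * ∏ j, ψ (x j)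

lemma partialSum_zero {K : ℕ} (x : Fin K → EuclideanSpace ℝ (Fin d)) : partialSum x 0 = 0 := by
  simp [partialSum]

lemma partialSum_cons_succ {K : ℕ} (a : EuclideanSpace ℝ (Fin d))
    (x : Fin K → EuclideanSpace ℝ (Fin d)) (n : ℕ) :
    partialSum (Fin.cons a x : Fin (K + 1) → EuclideanSpace ℝ (Fin d)) (n + 1)
      = a + partialSum x n := by
  simp [partialSum, Fin.sum_univ_succ]

lemma measurable_partialSum {K : ℕ} (n : ℕ) :
    Measurable fun x : Fin K → EuclideanSpace ℝ (Fin d) => partialSum x n := by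
  refine Finset.measurable_sum _ fun j _ => ?_
  split_ifs
  · exact measurable_pi_apply j
  · exact measurable_const

lemma walkIntegral_zero {ι : Type*} (g : ι → EuclideanSpace ℝ (Fin d) → ℝ≥0∞)
    (ψ : EuclideanSpace ℝ (Fin d) → ℝ≥0∞) (S : Finset ι) (k : ι → ℕ)
    (x₀ : EuclideanSpace ℝ (Fin d)) :
    walkIntegral g ψ 0 S k x₀ = 1 * ∏ i ∈ S, g i x₀ := by
  simp [walkIntegral, partialSum, lintegral_unique, volume_pi]

lemma walkIntegral_succ {ι : Type*} {g : ι → EuclideanSpace ℝ (Fin d) → ℝ≥0∞}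
    (hg : ∀ i, Measurable (g i)) {ψ : EuclideanSpace ℝ (Fin d) → ℝ≥0∞} (hψ : Measurable ψ)
    (K : ℕ) (S : Finset ι) (k : ι → ℕ) (x₀ : EuclideanSpace ℝ (Fin d)) :
    walkIntegral g ψ (K + 1) S k x₀
      = (∫⁻ a, ψ a * walkIntegral g ψ K (S.filter fun i => ¬ k i = 0) (fun i => k i - 1) (x₀ + a))
        * ∏ i ∈ S.filter fun i => k i = 0, g i x₀ := by
  let e := MeasurableEquiv.piFinSuccAbove (fun _ : Fin (K + 1) => EuclideanSpace ℝ (Fin d)) 0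
  have he : MeasurePreserving e.symm volume volume :=
    (volume_preserving_piFinSuccAbove (fun _ : Fin (K + 1) => EuclideanSpace ℝ (Fin d)) 0).symm e
  have hcons : ∀ p, e.symm p = Fin.cons p.1 p.2 := fun p => by
    simp [e, MeasurableEquiv.piFinSuccAbove, Fin.insertNthEquiv]
  have hGm : ∀ y, Measurable fun x : Fin K → EuclideanSpace ℝ (Fin d) =>
      (∏ i ∈ S.filter fun i => ¬ k i = 0, g i (y + partialSum x (k i - 1))) * ∏ j, ψ (x j) :=
    fun y => (Finset.measurable_prod _ fun i _ =>
      (hg i).comp ((measurable_partialSum _).const_add y)).mul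
      (Finset.measurable_prod _ fun j _ => hψ.comp (measurable_pi_apply j))
  have hF : Measurable fun x : Fin (K + 1) → EuclideanSpace ℝ (Fin d) =>
      (∏ i ∈ S, g i (x₀ + partialSum x (k i))) * ∏ j, ψ (x j) :=
    (Finset.measurable_prod _ fun i _ =>
      (hg i).comp ((measurable_partialSum _).const_add x₀)).mul
      (Finset.measurable_prod _ fun j _ => hψ.comp (measurable_pi_apply j))
  have hsplit : ∀ (a : EuclideanSpace ℝ (Fin d)) (x : Fin K → EuclideanSpace ℝ (Fin d)),
      (∏ i ∈ S, g i (x₀ + partialSum (Fin.cons a x : Fin (K + 1) → _) (k i)))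
          * ∏ j, ψ ((Fin.cons a x : Fin (K + 1) → EuclideanSpace ℝ (Fin d)) j)
        = (ψ a * ∏ i ∈ S.filter fun i => k i = 0, g i x₀)
          * ((∏ i ∈ S.filter fun i => ¬ k i = 0, g i (x₀ + a + partialSum x (k i - 1)))
            * ∏ j, ψ (x j)) := fun a x => by
    rw [← Finset.prod_filter_mul_prod_filter_not S fun i => k i = 0, Fin.prod_univ_succ]
    have h1 : ∏ i ∈ S.filter fun i => k i = 0,
        g i (x₀ + partialSum (Fin.cons a x : Fin (K + 1) → _) (k i))
          = ∏ i ∈ S.filter fun i => k i = 0, g i x₀ :=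
      Finset.prod_congr rfl fun i hi => by
        rw [(Finset.mem_filter.1 hi).2, partialSum_zero, add_zero]
    have h2 : ∏ i ∈ S.filter fun i => ¬ k i = 0,
        g i (x₀ + partialSum (Fin.cons a x : Fin (K + 1) → _) (k i))
          = ∏ i ∈ S.filter fun i => ¬ k i = 0, g i (x₀ + a + partialSum x (k i - 1)) :=
      Finset.prod_congr rfl fun i hi => by
        obtain ⟨n, hn⟩ := Nat.exists_eq_succ_of_ne_zero (Finset.mem_filter.1 hi).2
        rw [hn, Nat.succ_eq_add_one, partialSum_cons_succ, Nat.add_sub_cancel, add_assoc]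
    rw [h1, h2]
    simp only [Fin.cons_zero, Fin.cons_succ]
    ring
  have hFe : Measurable fun p => (∏ i ∈ S, g i (x₀ + partialSum (e.symm p) (k i)))
      * ∏ j, ψ (e.symm p j) := hF.comp he.measurable
  rw [walkIntegral, ← he.lintegral_comp hF, Measure.volume_eq_prod,
    lintegral_prod _ hFe.aemeasurable]
  have hW : ∀ a, ∫⁻ x : Fin K → EuclideanSpace ℝ (Fin d),
      (∏ i ∈ S, g i (x₀ + partialSum (e.symm (a, x)) (k i))) * ∏ j, ψ (e.symm (a, x) j)
        = ψ a * walkIntegral g ψ K (S.filter fun i => ¬ k i = 0) (fun i => k i - 1) (x₀ + a)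
          * ∏ i ∈ S.filter fun i => k i = 0, g i x₀ := fun a => by
    simp only [hcons, hsplit]
    rw [lintegral_const_mul _ (hGm _), walkIntegral]
    ring
  simp only [hW]
  refine lintegral_mul_const _ (hψ.mul ?_)
  refine Measurable.lintegral_prod_right' (ν := volume)
    (f := fun p : EuclideanSpace ℝ (Fin d) × (Fin K → EuclideanSpace ℝ (Fin d)) =>
      (∏ i ∈ S.filter fun i => ¬ k i = 0, g i (x₀ + p.1 + partialSum p.2 (k i - 1)))
        * ∏ j, ψ (p.2 j)) (Measurable.mul ?_ ?_)
  · refine Finset.measurable_prod _ fun i _ => (hg i).comp ?_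
    exact (measurable_fst.const_add x₀).add ((measurable_partialSum _).comp measurable_snd)
  · exact Finset.measurable_prod _ fun j _ =>
      hψ.comp ((measurable_pi_apply j).comp measurable_snd)

theorem rearrMajorized_walkIntegral (hd : 1 ≤ d) {ι : Type*}
    {f : ι → EuclideanSpace ℝ (Fin d) → ℝ} (hf : ∀ i, Measurable (f i))
    (hfv : ∀ i, VanishesAtInfinity (f i)) {φ : EuclideanSpace ℝ (Fin d) → ℝ} (hφ : Measurable φ)
    (hφv : VanishesAtInfinity φ) (K : ℕ) (S : Finset ι) (k : ι → ℕ) :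
    Measurable (walkIntegral (fun i x => ENNReal.ofReal (f i x))
        (fun x => ENNReal.ofReal (φ x)) K S k) ∧
      RadiallyAntitone (walkIntegral (fun i => symmRearrange (f i)) (symmRearrange φ) K S k) ∧
      RearrMajorized (walkIntegral (fun i x => ENNReal.ofReal (f i x))
        (fun x => ENNReal.ofReal (φ x)) K S k)
        (walkIntegral (fun i => symmRearrange (f i)) (symmRearrange φ) K S k) := by
  have hf' : ∀ i, Measurable fun x => ENNReal.ofReal (f i x) := fun i => (hf i).ennreal_ofReal
  have hφ' : Measurable fun x => ENNReal.ofReal (φ x) := hφ.ennreal_ofReal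
  have hs : ∀ i, RadiallyAntitone (symmRearrange (f i)) := fun i =>
    radiallyAntitone_symmRearrange (f i)
  have hφs : RadiallyAntitone (symmRearrange φ) := radiallyAntitone_symmRearrange φ
  have hone : RadiallyAntitone fun _ : EuclideanSpace ℝ (Fin d) => 1 := fun _ _ _ => le_rfl
  induction K generalizing S k with
  | zero =>
    simp only [funext (walkIntegral_zero _ _ S k)]
    exact ⟨measurable_const.mul (Finset.measurable_prod S fun i _ => hf' i),
      hone.mul (radiallyAntitone_finset_prod S hs),
      (rearrMajorized_one hd).mul_prod_ofReal hf hfv S measurable_const hone⟩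
  | succ K ih =>
    obtain ⟨ihm, iha, ihr⟩ := ih (S.filter fun i => ¬ k i = 0) fun i => k i - 1
    rw [funext (walkIntegral_succ hf' hφ' K S k),
      funext (walkIntegral_succ (fun i => (hs i).measurable) hφs.measurable K S k)]
    have hm : Measurable fun y => ∫⁻ a, ENNReal.ofReal (φ a) *
        walkIntegral (fun i x => ENNReal.ofReal (f i x)) (fun x => ENNReal.ofReal (φ x)) K
          (S.filter fun i => ¬ k i = 0) (fun i => k i - 1) (y + a) :=
      Measurable.lintegral_prod_right' (f := fun p : EuclideanSpace ℝ (Fin d) × _ => _)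
        ((hφ'.comp measurable_snd).mul (ihm.comp (measurable_fst.add measurable_snd)))
    have ha := hφs.lintegral_mul_comp_add iha
    exact ⟨hm.mul (Finset.measurable_prod _ fun i _ => hf' i),
      ha.mul (radiallyAntitone_finset_prod _ hs),
      (ihr.lintegral_comp_add hd ihm iha hφ hφv).mul_prod_ofReal hf hfv _ hm ha⟩

lemma RearrMajorized.ae_le_apply_zero (hd : 1 ≤ d) {u v : EuclideanSpace ℝ (Fin d) → ℝ≥0∞}
    (huv : RearrMajorized u v) (hu : Measurable u) (hv : RadiallyAntitone v) :
    ∀ᵐ x, u x ≤ v 0 := by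
  refine ae_le_of_forall_setLIntegral_le_of_sigmaFinite (g := fun _ => v 0) hu fun A hA hA' => ?_
  calc ∫⁻ x in A, u x ≤ ∫⁻ x in ballStar A, v x := huv A hA hA'.ne
    _ ≤ ∫⁻ _ in ballStar A, v 0 := lintegral_mono fun x => hv (by simp)
    _ = ∫⁻ _ in A, v 0 := by simp [volume_ballStar hd hA'.ne]

end RandomWalk

/-- **Rearrangement inequality for random walks (measurable case, almost everywhere).** -/
theorem random_walk_rearrangement_ae {d m : ℕ} (hd : 1 ≤ d) (hm : 1 ≤ m)
    (φ : EuclideanSpace ℝ (Fin d) → ℝ) (hφ_meas : Measurable φ)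
    (hφ_nonneg : ∀ y, 0 ≤ φ y)
    (hφ_prob : ∫⁻ y, ENNReal.ofReal (φ y) = 1)
    (hφ_van : VanishesAtInfinity φ)
    (f : Fin m → EuclideanSpace ℝ (Fin d) → ℝ)
    (hf_meas : ∀ i, Measurable (f i))
    (hf_nonneg : ∀ i x, 0 ≤ f i x)
    (hf_van : ∀ i, VanishesAtInfinity (f i))
    (k : Fin m → ℕ) (hk_mono : Monotone k)
    (K : ℕ) (hK : K = k ⟨m - 1, Nat.sub_lt hm Nat.one_pos⟩) (hK1 : 1 ≤ K) :
    ∀ᵐ x₀ : EuclideanSpace ℝ (Fin d) ∂volume,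
      (∫⁻ x : Fin K → EuclideanSpace ℝ (Fin d),
          (∏ i, ENNReal.ofReal (f i (x₀ + partialSum x (k i)))) *
            ∏ j, ENNReal.ofReal (φ (x j))) ≤
        ∫⁻ x : Fin K → EuclideanSpace ℝ (Fin d),
          (∏ i, symmRearrange (f i) (partialSum x (k i))) *
            ∏ j, symmRearrange φ (x j) := by

  obtain ⟨hm', ha, hr⟩ := rearrMajorized_walkIntegral hd hf_meas hf_van hφ_meas hφ_van K
    Finset.univ k
  filter_upwards [hr.ae_le_apply_zero hd hm' ha] with x₀ hx₀
  simpa only [walkIntegral, zero_add] using hx₀
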